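/- arXiv:2104.09012 — 2 statements merged into one kernel-verified Lean document; each statement's English description precedes it below -/
import Mathlib

section
/- There exists τ₀ > 0 (depending only on d) such that the following holds. Let Ω ⊂ ℝ^d be a domain and B a ball centered on ∂Ω with ∂Ω ∩ B ∈ Lip(τ), τ < τ₀. Then for any function h continuous on the closure of Ω, harmonic in Ω, and vanishing on ∂Ω ∩ B, and for any ball B₀ with center in closure(Ω) ∩ (1/4)B such that 16B₀ ⊂ B, one has sup over (3/2)B₀ ∩ Ω of |h| ≤ 3^d · (sup over B₀ ∩ Ω of |h|)^{1/3} · (sup over 4B₀ ∩ Ω of |h|)^{2/3}. -/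
open Metric MeasureTheory Set
open scoped ENNReal NNReal

noncomputable section

/-- `Euc m` is the Euclidean space `ℝ^(m+1)`. -/
abbrev Euc (m : ℕ) : Type := EuclideanSpace ℝ (Fin (m + 1))

/-- The first `m` coordinates of a point of `ℝ^(m+1)`. -/
def front {m : ℕ} (y : Euc m) : EuclideanSpace ℝ (Fin m) :=
  (WithLp.equiv 2 (∀ _ : Fin m, ℝ)).symm fun i : Fin m => y i.castSucc

/-- The last coordinate of a point of `ℝ^(m+1)`. -/
def lastC {m : ℕ} (y : Euc m) : ℝ := y (Fin.last m)

/-- The unit vector of `ℝ^(m+1)` in the last coordinate direction. -/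
def eLast (m : ℕ) : Euc m := EuclideanSpace.single (Fin.last m) 1

/-- The point `(x', 0) ∈ ℝ^(m+1)` determined by `x' ∈ ℝ^m`. -/
def pad {m : ℕ} (x' : EuclideanSpace ℝ (Fin m)) : Euc m :=
  (WithLp.equiv 2 (∀ _ : Fin (m + 1), ℝ)).symm
    (Fin.snoc (WithLp.equiv 2 (∀ _ : Fin m, ℝ) x') 0)

/-- The Laplacian of `h : ℝ^d → ℝ` at `x`: the sum of the pure second derivatives in the
coordinate directions. -/
def lap {d : ℕ} (h : EuclideanSpace ℝ (Fin d) → ℝ) (x : EuclideanSpace ℝ (Fin d)) : ℝ :=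
  ∑ i : Fin d, iteratedFDeriv ℝ 2 h x ![EuclideanSpace.single i 1, EuclideanSpace.single i 1]

/-- `h` is harmonic on `Ω`: it is twice continuously differentiable there and its
Laplacian vanishes. -/
def IsHarmonicOn {d : ℕ} (h : EuclideanSpace ℝ (Fin d) → ℝ)
    (Ω : Set (EuclideanSpace ℝ (Fin d))) : Prop :=
  ContDiffOn ℝ 2 h Ω ∧ ∀ x ∈ Ω, lap h x = 0

/-- `H_h(x,r) = ∫_{B(x,r) ∩ Ω} h²`. -/
def Hh {d : ℕ} (Ω : Set (EuclideanSpace ℝ (Fin d))) (h : EuclideanSpace ℝ (Fin d) → ℝ)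
    (x : EuclideanSpace ℝ (Fin d)) (r : ℝ) : ℝ :=
  ∫ y in ball x r ∩ Ω, (h y) ^ 2

/-- The doubling index `N_h(x,r) = log (H_h(x,2r) / H_h(x,r))`. -/
def Nh {d : ℕ} (Ω : Set (EuclideanSpace ℝ (Fin d))) (h : EuclideanSpace ℝ (Fin d) → ℝ)
    (x : EuclideanSpace ℝ (Fin d)) (r : ℝ) : ℝ :=
  Real.log (Hh Ω h x (2 * r) / Hh Ω h x r)

/-- `∂Ω ∩ B(x,r) ∈ Lip(τ)`: in suitable isometric coordinates centered at `x`, `Ω ∩ B(x,r)`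
is the region above the graph of a `τ`-Lipschitz function `f` with `f 0 = 0`. -/
def LipGraph {m : ℕ} (Ω : Set (Euc m)) (τ : ℝ≥0) (x : Euc m) (r : ℝ) : Prop :=
  ∃ T : Euc m ≃ᵢ Euc m, ∃ f : EuclideanSpace ℝ (Fin m) → ℝ,
    T 0 = x ∧ LipschitzOnWith τ f (ball 0 r) ∧ f 0 = 0 ∧
    Ω ∩ ball x r = T '' {y : Euc m | y ∈ ball (0 : Euc m) r ∧ f (front y) < lastC y}

/-- `∂Ω ∩ B(x,r)` is a `C^k`-smooth graph: same as `LipGraph` but with a `C^k` function. -/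
def SmoothGraph {m : ℕ} (k : ℕ) (Ω : Set (Euc m)) (x : Euc m) (r : ℝ) : Prop :=
  ∃ T : Euc m ≃ᵢ Euc m, ∃ f : EuclideanSpace ℝ (Fin m) → ℝ,
    T 0 = x ∧ ContDiffOn ℝ k f (ball 0 r) ∧ f 0 = 0 ∧
    Ω ∩ ball x r = T '' {y : Euc m | y ∈ ball (0 : Euc m) r ∧ f (front y) < lastC y}

/-- The closed axis-parallel cube with center `p` and side length `s`. -/
def cube {d : ℕ} (p : EuclideanSpace ℝ (Fin d)) (s : ℝ) : Set (EuclideanSpace ℝ (Fin d)) :=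
  {y | ∀ i, |y i - p i| ≤ s / 2}

/-- The maximal doubling index `N*_h(Q)` of `h` in the cube `Q`. -/
def Nstar {d : ℕ} (Ω : Set (EuclideanSpace ℝ (Fin d))) (h : EuclideanSpace ℝ (Fin d) → ℝ)
    (Q : Set (EuclideanSpace ℝ (Fin d))) : ℝ :=
  sSup {N : ℝ | ∃ x ∈ Q ∩ closure Ω, ∃ r : ℝ,
    Metric.diam Q / 2 ≤ r ∧ r ≤ Metric.diam Q ∧ N = Nh Ω h x r}

/-- Centers of the boundary cubes `q ∈ B_k(Q)` of the standard construction: `z` lies on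
`∂Ω ∩ Q` and its horizontal projection is the center of one of the `2^(k·m)` congruent
subcubes of side `s/2^k` partitioning the projection of `Q`. -/
def bCenters {m : ℕ} (Ω : Set (Euc m)) (xQ : Euc m) (s : ℝ) (k : ℕ) : Set (Euc m) :=
  {z | z ∈ frontier Ω ∩ cube xQ s ∧
    ∃ j : Fin m → Fin (2 ^ k), ∀ i : Fin m,
      front z i = front xQ i - s / 2 + (s / 2 ^ k) * ((j i : ℝ) + 1 / 2)}

/-- `Esp d` is the Euclidean space `ℝ^d`. -/
abbrev Esp (d : ℕ) : Type := EuclideanSpace ℝ (Fin d)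

/-- The Euclidean pairing of two linear forms, in coordinates. -/
def formDot {d : ℕ} (A B : Esp d →L[ℝ] ℝ) : ℝ :=
  ∑ i : Fin d, A (EuclideanSpace.single i 1) * B (EuclideanSpace.single i 1)

/-- `u` is continuous on `U`, harmonic in `Ω` and vanishes outside `Ω`. -/
structure HarmonicZeroExt {d : ℕ} (U Ω : Set (Esp d)) (u : Esp d → ℝ) : Prop where
  isOpen_dom : IsOpen U
  isOpen_set : IsOpen Ω
  cont : ContinuousOn u U
  zero : ∀ x ∉ Ω, u x = 0
  smooth : ContDiffOn ℝ 2 u Ω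
  lap_eq : ∀ x ∈ Ω, lap u x = 0

/-- The weight `(1 - |x|²)₊² (1 + 2|x|²)`. -/
def wt {d : ℕ} (x : Esp d) : ℝ := (max (1 - ‖x‖ ^ 2) 0) ^ 2 * (1 + 2 * ‖x‖ ^ 2)

/-- The potential of the field `-wt x • x`. -/
def wtPot {d : ℕ} (x : Esp d) : ℝ := 1 / 4 * ((max (1 - ‖x‖ ^ 2) 0) ^ 3 * (1 + ‖x‖ ^ 2))

/-- Minus the divergence of the field `wt x • x`. -/
def wtDiv {d : ℕ} (x : Esp d) : ℝ :=
  12 * ‖x‖ ^ 4 * max (1 - ‖x‖ ^ 2) 0 - d * wt x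

section FormCalculus

variable {d : ℕ}

theorem formDot_add_left (A A' B : Esp d →L[ℝ] ℝ) :
    formDot (A + A') B = formDot A B + formDot A' B := by
  simp [formDot, add_mul, Finset.sum_add_distrib]

theorem formDot_smul_left (c : ℝ) (A B : Esp d →L[ℝ] ℝ) :
    formDot (c • A) B = c * formDot A B := by
  simp [formDot, Finset.mul_sum, mul_assoc]

theorem formDot_self_nonneg (A : Esp d →L[ℝ] ℝ) : 0 ≤ formDot A A :=
  Finset.sum_nonneg fun _ _ => mul_self_nonneg _

theorem continuous_formDot : Continuous fun p : (Esp d →L[ℝ] ℝ) × (Esp d →L[ℝ] ℝ) =>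
    formDot p.1 p.2 := by
  unfold formDot; fun_prop

theorem formDot_innerSL (x : Esp d) (B : Esp d →L[ℝ] ℝ) : formDot (innerSL ℝ x) B = B x := by
  have hx : x = ∑ i : Fin d, x i • EuclideanSpace.single i (1 : ℝ) := by
    ext j; simp [Finset.sum_apply, Pi.single_apply]
  conv_rhs => rw [hx]
  simp [formDot, EuclideanSpace.inner_single_right]

theorem two_mul_formDot_le (A B : Esp d →L[ℝ] ℝ) {η : ℝ} (hη : 0 < η) :
    2 * formDot A B ≤ η * formDot A A + formDot B B / η := by
  unfold formDot
  rw [Finset.mul_sum, Finset.mul_sum, Finset.sum_div, ← Finset.sum_add_distrib]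
  refine Finset.sum_le_sum fun i _ => ?_
  set a := A (EuclideanSpace.single i 1)
  set b := B (EuclideanSpace.single i 1)
  have : 0 ≤ (η * a - b) ^ 2 / η := by positivity
  have h2 : (η * a - b) ^ 2 / η = η * (a * a) + b * b / η - 2 * (a * b) := by
    field_simp; ring
  linarith

theorem formDot_le (A B : Esp d →L[ℝ] ℝ) {η : ℝ} (hη : 0 < η) :
    formDot A B ≤ (η * formDot A A + formDot B B / η) / 2 := by
  linarith [two_mul_formDot_le A B hη]

theorem integral_fderiv_eq_zero {W : Esp d → ℝ} (hW : ContDiff ℝ 1 W) (hc : HasCompactSupport W)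
    (v : Esp d) : ∫ x, fderiv ℝ W x v = 0 := by
  have h1 : Continuous fun x => fderiv ℝ W x v :=
    (hW.continuous_fderiv (by simp)).clm_apply continuous_const
  have hi : Integrable fun x => fderiv ℝ W x v :=
    h1.integrable_of_hasCompactSupport (hc.fderiv_apply ℝ v)
  have := integral_mul_fderiv_eq_neg_fderiv_mul_of_integrable (μ := volume) (f := W)
    (g := fun _ => (1 : ℝ)) (v := v) (by simpa using hi) (by simp)
    (by simpa using hW.continuous.integrable_of_hasCompactSupport hc)
    (fun x _ => hW.differentiable (by simp) x) (fun x _ => differentiableAt_const _)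
  simpa using this.symm

theorem contDiff_of_tsupport_subset {n : WithTop ℕ∞} {V : Set (Esp d)} (hV : IsOpen V)
    {a : Esp d → ℝ} (ha : ContDiffOn ℝ n a V) (hs : tsupport a ⊆ V) : ContDiff ℝ n a :=
  contDiff_iff_contDiffAt.2 fun x => by
    by_cases hx : x ∈ tsupport a
    · exact (ha x (hs hx)).contDiffAt (hV.mem_nhds (hs hx))
    · exact contDiffAt_const.congr_of_eventuallyEq (notMem_tsupport_iff_eventuallyEq.1 hx)

/-- Weak form of harmonicity. -/
theorem integral_formDot_eq_zero {Ω : Set (Esp d)} (hΩ : IsOpen Ω) {a b : Esp d → ℝ}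
    (ha : ContDiff ℝ 1 a) (hc : HasCompactSupport a) (hs : tsupport a ⊆ Ω)
    (hb : ContDiffOn ℝ 2 b Ω) (hl : ∀ x ∈ Ω, lap b x = 0) :
    ∫ x, formDot (fderiv ℝ a x) (fderiv ℝ b x) = 0 := by
  have hdb : ContDiffOn ℝ 1 (fderiv ℝ b) Ω := hb.fderiv_of_isOpen hΩ (by norm_num)
  set e : Fin d → Esp d := fun i => EuclideanSpace.single i 1
  have hW : ∀ i, ContDiff ℝ 1 (fun x => a x * fderiv ℝ b x (e i)) := fun i =>
    contDiff_of_tsupport_subset hΩ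
      (ha.contDiffOn.mul (hdb.clm_apply contDiffOn_const))
      ((tsupport_mul_subset_left).trans hs)
  have hWc : ∀ i, HasCompactSupport (fun x => a x * fderiv ℝ b x (e i)) := fun i => hc.mul_right
  have hpt : ∀ x, formDot (fderiv ℝ a x) (fderiv ℝ b x) =
      ∑ i, fderiv ℝ (fun x => a x * fderiv ℝ b x (e i)) x (e i) := by
    intro x
    by_cases hx : x ∈ tsupport a
    · have hxΩ := hs hx
      have h1 : DifferentiableAt ℝ (fderiv ℝ b) x :=
        ((hdb x hxΩ).contDiffAt (hΩ.mem_nhds hxΩ)).differentiableAt (by simp)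
      have h2 : DifferentiableAt ℝ a x := ha.differentiable (by simp) x
      have h3 : ∀ i, fderiv ℝ (fun x => a x * fderiv ℝ b x (e i)) x (e i) =
          fderiv ℝ a x (e i) * fderiv ℝ b x (e i) +
            a x * iteratedFDeriv ℝ 2 b x ![e i, e i] := by
        intro i
        have h4 : HasFDerivAt (fun x => fderiv ℝ b x (e i))
            ((ContinuousLinearMap.apply ℝ ℝ (e i)).comp (fderiv ℝ (fderiv ℝ b) x)) x :=
          (ContinuousLinearMap.apply ℝ ℝ (e i)).hasFDerivAt.comp x h1.hasFDerivAt
        rw [(h2.hasFDerivAt.fun_mul h4).fderiv, iteratedFDeriv_two_apply]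
        simp; ring
      simp_rw [h3]
      rw [Finset.sum_add_distrib, ← Finset.mul_sum]
      have := hl x hxΩ
      unfold lap at this
      rw [this]; simp [formDot, e]
    · have h0 : a =ᶠ[nhds x] 0 := notMem_tsupport_iff_eventuallyEq.1 hx
      have h1 : fderiv ℝ a x = 0 := by rw [h0.fderiv_eq]; simp
      have h2 : ∀ i, fderiv ℝ (fun x => a x * fderiv ℝ b x (e i)) x = 0 := by
        intro i
        have : (fun x => a x * fderiv ℝ b x (e i)) =ᶠ[nhds x] fun _ => 0 := by
          filter_upwards [h0] with y hy; simp [hy]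
        rw [this.fderiv_eq]; simp
      simp [h1, h2, formDot]
  simp_rw [hpt]
  rw [integral_finsetSum]
  · exact Finset.sum_eq_zero fun i _ => integral_fderiv_eq_zero (hW i) (hWc i) _
  · intro i _
    exact (((hW i).continuous_fderiv (by simp)).clm_apply
      continuous_const).integrable_of_hasCompactSupport ((hWc i).fderiv_apply ℝ _)

/-- The divergence theorem for the field `a x • x`. -/
theorem integral_radial_eq {a : Esp d → ℝ} (ha : ContDiff ℝ 1 a) (hc : HasCompactSupport a) :
    ∫ x, (fderiv ℝ a x x + d * a x) = 0 := by
  set e : Fin d → Esp d := fun i => EuclideanSpace.single i 1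
  have hp : ∀ i, ContDiff ℝ 1 (fun x : Esp d => x i) := fun i =>
    (EuclideanSpace.proj (𝕜 := ℝ) i).contDiff
  have hW : ∀ i, ContDiff ℝ 1 (fun x => a x * x i) := fun i => ha.mul (hp i)
  have hWc : ∀ i, HasCompactSupport (fun x => a x * x i) := fun i => hc.mul_right
  have hpt : ∀ x, fderiv ℝ a x x + d * a x = ∑ i, fderiv ℝ (fun x => a x * x i) x (e i) := by
    intro x
    have h3 : ∀ i, fderiv ℝ (fun x => a x * x i) x (e i) = x i * fderiv ℝ a x (e i) + a x := by
      intro i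
      have h4 : HasFDerivAt (fun x : Esp d => x i) (EuclideanSpace.proj (𝕜 := ℝ) i) x :=
        (EuclideanSpace.proj (𝕜 := ℝ) i).hasFDerivAt
      rw [((ha.differentiable (by simp) x).hasFDerivAt.fun_mul h4).fderiv]
      simp [e]; ring
    simp_rw [h3]
    rw [Finset.sum_add_distrib, ← formDot_innerSL]
    simp [formDot, e, EuclideanSpace.inner_single_right]
  simp_rw [hpt]
  rw [integral_finsetSum]
  · exact Finset.sum_eq_zero fun i _ => integral_fderiv_eq_zero (hW i) (hWc i) _
  · intro i _
    exact (((hW i).continuous_fderiv (by simp)).clm_apply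
      continuous_const).integrable_of_hasCompactSupport ((hWc i).fderiv_apply ℝ _)

end FormCalculus

section Weights

theorem hasDerivAt_max_zero_pow (n : ℕ) (t : ℝ) :
    HasDerivAt (fun s : ℝ => max s 0 ^ (n + 2)) ((n + 2) * max t 0 ^ (n + 1)) t := by
  have key : ∀ y : ℝ, y ≠ 0 →
      HasDerivAt (fun s : ℝ => max s 0 ^ (n + 2)) ((n + 2) * max y 0 ^ (n + 1)) y := by
    intro y hy
    rcases lt_or_gt_of_ne hy with h | h
    · have : (fun s : ℝ => max s 0 ^ (n + 2)) =ᶠ[nhds y] fun _ => 0 := by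
        filter_upwards [gt_mem_nhds h] with s hs
        simp [max_eq_right hs.le]
      simpa [max_eq_right h.le] using (hasDerivAt_const y (0 : ℝ)).congr_of_eventuallyEq this
    · have : (fun s : ℝ => max s 0 ^ (n + 2)) =ᶠ[nhds y] fun s => s ^ (n + 2) := by
        filter_upwards [lt_mem_nhds h] with s hs
        simp [max_eq_left hs.le]
      have h2 := (hasDerivAt_pow (n + 2) y).congr_of_eventuallyEq this
      simpa [max_eq_left h.le] using h2
  rcases eq_or_ne t 0 with rfl | ht
  · exact hasDerivAt_of_hasDerivAt_of_ne (g := fun y => (n + 2) * max y 0 ^ (n + 1)) key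
      (by fun_prop) (by fun_prop)
  · exact key t ht

variable {d : ℕ}

theorem hasFDerivAt_max_one_sub_pow (n : ℕ) (x : Esp d) :
    HasFDerivAt (fun y : Esp d => max (1 - ‖y‖ ^ 2) 0 ^ (n + 2))
      (((-2 : ℝ) * (((n : ℝ) + 2) * max (1 - ‖x‖ ^ 2) 0 ^ (n + 1))) • innerSL ℝ x) x := by
  have h1 : HasFDerivAt (fun y : Esp d => 1 - ‖y‖ ^ 2) (-(2 • innerSL ℝ x)) x :=
    (hasStrictFDerivAt_norm_sq x).hasFDerivAt.const_sub 1
  have h2 := (hasDerivAt_max_zero_pow n (1 - ‖x‖ ^ 2)).comp_hasFDerivAt x h1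
  refine h2.congr_fderiv ?_
  ext v
  simp
  ring

theorem hasFDerivAt_wtPot (x : Esp d) :
    HasFDerivAt (wtPot (d := d)) ((-(wt x)) • innerSL ℝ x) x := by
  have h1 := hasFDerivAt_max_one_sub_pow 1 x
  have h2 : HasFDerivAt (fun y : Esp d => 1 + ‖y‖ ^ 2) (2 • innerSL ℝ x) x :=
    (hasStrictFDerivAt_norm_sq x).hasFDerivAt.const_add 1
  refine ((h1.fun_mul h2).const_mul (1 / 4)).congr_fderiv ?_
  ext v
  simp [wt]
  rcases le_total (1 - ‖x‖ ^ 2) 0 with h | h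
  · simp [max_eq_right h]
  · rw [max_eq_left h]; ring

theorem hasFDerivAt_wt (x : Esp d) :
    HasFDerivAt (wt (d := d)) ((-(12 * ‖x‖ ^ 2 * max (1 - ‖x‖ ^ 2) 0)) • innerSL ℝ x) x := by
  have h1 := hasFDerivAt_max_one_sub_pow 0 x
  have h2 : HasFDerivAt (fun y : Esp d => 1 + 2 * ‖y‖ ^ 2) ((2 : ℝ) • (2 • innerSL ℝ x)) x :=
    ((hasStrictFDerivAt_norm_sq x).hasFDerivAt.const_mul 2).const_add 1
  refine (h1.fun_mul h2).congr_fderiv ?_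
  ext v
  simp
  rcases le_total (1 - ‖x‖ ^ 2) 0 with h | h
  · simp [max_eq_right h]
  · rw [max_eq_left h]; ring

@[fun_prop]
theorem continuous_wt : Continuous (wt (d := d)) := by unfold wt; fun_prop

@[fun_prop]
theorem continuous_wtPot : Continuous (wtPot (d := d)) := by unfold wtPot; fun_prop

@[fun_prop]
theorem continuous_wtDiv : Continuous (wtDiv (d := d)) := by unfold wtDiv; fun_prop

theorem contDiff_wt : ContDiff ℝ 1 (wt (d := d)) :=
  contDiff_one_iff_hasFDerivAt.2 ⟨_, by fun_prop, hasFDerivAt_wt⟩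

theorem contDiff_wtPot : ContDiff ℝ 1 (wtPot (d := d)) :=
  contDiff_one_iff_hasFDerivAt.2 ⟨_, by fun_prop, hasFDerivAt_wtPot⟩

theorem wt_nonneg (x : Esp d) : 0 ≤ wt x := by unfold wt; positivity

theorem wtPot_nonneg (x : Esp d) : 0 ≤ wtPot x := by unfold wtPot; positivity

theorem one_sub_norm_sq_nonpos {x : Esp d} (hx : x ∉ closedBall (0 : Esp d) 1) :
    1 - ‖x‖ ^ 2 ≤ 0 := by
  have : 1 < ‖x‖ := by simpa using hx
  nlinarith

theorem wt_eq_zero {x : Esp d} (hx : x ∉ closedBall (0 : Esp d) 1) : wt x = 0 := by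
  simp [wt, max_eq_right (one_sub_norm_sq_nonpos hx)]

theorem wtPot_eq_zero {x : Esp d} (hx : x ∉ closedBall (0 : Esp d) 1) : wtPot x = 0 := by
  simp [wtPot, max_eq_right (one_sub_norm_sq_nonpos hx)]

theorem wtDiv_eq_zero {x : Esp d} (hx : x ∉ closedBall (0 : Esp d) 1) : wtDiv x = 0 := by
  simp [wtDiv, wt, max_eq_right (one_sub_norm_sq_nonpos hx)]

theorem wt_pos {x : Esp d} (hx : x ∈ ball (0 : Esp d) 1) : 0 < wt x := by
  have h : ‖x‖ < 1 := by simpa using hx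
  have : 0 < 1 - ‖x‖ ^ 2 := by nlinarith [norm_nonneg x]
  unfold wt
  rw [max_eq_left this.le]
  positivity

theorem hasCompactSupport_of_eq_zero {a : Esp d → ℝ}
    (h : ∀ x ∉ closedBall (0 : Esp d) 1, a x = 0) : HasCompactSupport a :=
  HasCompactSupport.intro (isCompact_closedBall 0 1) fun x hx => h x hx

theorem exists_abs_le_of_eq_zero {a : Esp d → ℝ} (hc : Continuous a)
    (h : ∀ x ∉ closedBall (0 : Esp d) 1, a x = 0) : ∃ C, 0 ≤ C ∧ ∀ x, |a x| ≤ C := by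
  obtain ⟨C, hC⟩ := hc.bounded_above_of_compact_support (hasCompactSupport_of_eq_zero h)
  exact ⟨C, (norm_nonneg _).trans (hC 0), hC⟩

theorem fderiv_wt_apply_self (x : Esp d) : fderiv ℝ wt x x = -(wtDiv x + d * wt x) := by
  rw [(hasFDerivAt_wt x).fderiv]
  simp [wtDiv]
  ring

/-- A product of a continuous weight supported in the closed unit ball and a function continuous
near that ball is integrable. -/
theorem integrable_weight_mul {a w : Esp d → ℝ} (hc : Continuous a)
    (h : ∀ x ∉ closedBall (0 : Esp d) 1, a x = 0) (hw : ContinuousOn w (closedBall 0 1)) :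
    Integrable fun x => a x * w x := by
  have h1 : IntegrableOn (fun x => a x * w x) (closedBall 0 1) :=
    (hc.continuousOn.mul hw).integrableOn_compact (isCompact_closedBall 0 1)
  refine (integrableOn_iff_integrable_of_support_subset ?_).1 h1
  intro x hx
  by_contra hn
  exact hx (by simp [h x hn])

theorem integral_wt_pos : 0 < ∫ x : Esp d, wt x := by
  have hcs := hasCompactSupport_of_eq_zero (d := d) fun x hx => wt_eq_zero hx
  exact continuous_wt.integral_pos_of_hasCompactSupport_nonneg_nonzero hcs wt_nonneg
    (x := 0) (wt_pos (by simp)).ne'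

end Weights

/-- A continuous slope vanishing on `[-ε, ε]` and equal to `1` outside `(-2ε, 2ε)`. -/
def cutSlope (ε t : ℝ) : ℝ := min 1 (max 0 (|t| / ε - 1))

/-- A `C¹` truncation of the identity, vanishing on `[-ε, ε]`. -/
def trunc (ε t : ℝ) : ℝ := ∫ r in (0 : ℝ)..t, cutSlope ε r

/-- The primitive of `trunc`, an approximation of `t² / 2`. -/
def truncPrim (ε t : ℝ) : ℝ := ∫ r in (0 : ℝ)..t, trunc ε r

section Truncation

variable {ε : ℝ}

@[fun_prop]
theorem continuous_cutSlope : Continuous (cutSlope ε) := by unfold cutSlope; fun_prop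

theorem cutSlope_nonneg (t : ℝ) : 0 ≤ cutSlope ε t := by unfold cutSlope; positivity

theorem cutSlope_le_one (t : ℝ) : cutSlope ε t ≤ 1 := min_le_left _ _

theorem cutSlope_eq_zero (hε : 0 < ε) {t : ℝ} (ht : |t| ≤ ε) : cutSlope ε t = 0 := by
  have : |t| / ε - 1 ≤ 0 := by rw [sub_nonpos, div_le_one hε]; exact ht
  simp [cutSlope, max_eq_left this]

theorem cutSlope_eq_one (hε : 0 < ε) {t : ℝ} (ht : 2 * ε ≤ |t|) : cutSlope ε t = 1 := by
  have : 1 ≤ |t| / ε - 1 := by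
    have : 2 ≤ |t| / ε := by rwa [le_div_iff₀ hε]
    linarith
  rw [cutSlope, min_eq_left]
  exact this.trans (le_max_right _ _)

theorem hasDerivAt_trunc (t : ℝ) : HasDerivAt (trunc ε) (cutSlope ε t) t :=
  intervalIntegral.integral_hasDerivAt_right (continuous_cutSlope.intervalIntegrable _ _)
    (continuous_cutSlope.stronglyMeasurableAtFilter _ _) continuous_cutSlope.continuousAt

@[fun_prop]
theorem continuous_trunc : Continuous (trunc ε) :=
  continuous_iff_continuousAt.2 fun t => (hasDerivAt_trunc t).continuousAt

theorem hasDerivAt_truncPrim (t : ℝ) : HasDerivAt (truncPrim ε) (trunc ε t) t :=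
  intervalIntegral.integral_hasDerivAt_right (continuous_trunc.intervalIntegrable _ _)
    (continuous_trunc.stronglyMeasurableAtFilter _ _) continuous_trunc.continuousAt

@[fun_prop]
theorem continuous_truncPrim : Continuous (truncPrim ε) :=
  continuous_iff_continuousAt.2 fun t => (hasDerivAt_truncPrim t).continuousAt

theorem contDiff_one_of_hasDerivAt {ψ ψ' : ℝ → ℝ} (hψ : ∀ t, HasDerivAt ψ (ψ' t) t)
    (hc : Continuous ψ') : ContDiff ℝ 1 ψ := by
  rw [contDiff_one_iff_deriv]
  refine ⟨fun t => (hψ t).differentiableAt, ?_⟩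
  rwa [show deriv ψ = ψ' from funext fun t => (hψ t).deriv]

theorem abs_le_of_mem_uIcc_zero {r t : ℝ} (hr : r ∈ uIcc 0 t) : |r| ≤ |t| := by
  simpa using abs_sub_left_of_mem_uIcc hr

theorem trunc_eq_zero (hε : 0 < ε) {t : ℝ} (ht : |t| ≤ ε) : trunc ε t = 0 := by
  rw [trunc, intervalIntegral.integral_congr (g := fun _ => 0)]
  · simp
  · intro r hr
    exact cutSlope_eq_zero hε ((abs_le_of_mem_uIcc_zero hr).trans ht)

theorem truncPrim_eq_zero (hε : 0 < ε) {t : ℝ} (ht : |t| ≤ ε) : truncPrim ε t = 0 := by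
  rw [truncPrim, intervalIntegral.integral_congr (g := fun _ => 0)]
  · simp
  · intro r hr
    exact trunc_eq_zero hε ((abs_le_of_mem_uIcc_zero hr).trans ht)

theorem abs_trunc_sub_le (hε : 0 < ε) (t : ℝ) : |trunc ε t - t| ≤ 2 * ε := by
  have hi : ∀ a b : ℝ, IntervalIntegrable (fun r => cutSlope ε r - 1) volume a b := fun a b =>
    (Continuous.intervalIntegrable (by fun_prop) _ _)
  have h1 : trunc ε t - t = ∫ r in (0 : ℝ)..t, (cutSlope ε r - 1) := by
    rw [intervalIntegral.integral_sub (continuous_cutSlope.intervalIntegrable _ _)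
      (by simp)]
    simp [trunc]
  obtain ⟨m, hm, hmt⟩ : ∃ m : ℝ, |m| ≤ 2 * ε ∧ ∀ r ∈ uIcc m t, m = t ∨ 2 * ε ≤ |r| := by
    rcases le_total |t| (2 * ε) with h | h
    · exact ⟨t, h, fun r _ => Or.inl rfl⟩
    · rcases le_total 0 t with h0 | h0
      · refine ⟨2 * ε, by rw [abs_of_pos (by positivity)], fun r hr => Or.inr ?_⟩
        rw [abs_of_nonneg h0] at h
        rw [uIcc_of_le h] at hr
        exact hr.1.trans (le_abs_self r)
      · refine ⟨-(2 * ε), by rw [abs_neg, abs_of_pos (by positivity)], fun r hr => Or.inr ?_⟩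
        rw [abs_of_nonpos h0] at h
        rw [uIcc_of_ge (by linarith)] at hr
        exact (by linarith [hr.2] : 2 * ε ≤ -r).trans (neg_le_abs r)
  have h2 : ∫ r in m..t, (cutSlope ε r - 1) = 0 := by
    by_cases hmt' : m = t
    · simp [hmt']
    · rw [intervalIntegral.integral_congr (g := fun _ => 0)]
      · simp
      · intro r hr
        simp [cutSlope_eq_one hε ((hmt r hr).resolve_left hmt')]
  rw [h1, ← intervalIntegral.integral_add_adjacent_intervals (hi 0 m) (hi m t), h2, add_zero]
  have := intervalIntegral.norm_integral_le_of_norm_le_const (a := 0) (b := m) (C := 1)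
    (f := fun r => cutSlope ε r - 1) (fun r _ => by
      rw [Real.norm_eq_abs, abs_le]
      constructor <;> linarith [cutSlope_nonneg (ε := ε) r, cutSlope_le_one (ε := ε) r])
  rw [Real.norm_eq_abs] at this
  simpa using this.trans (by simpa using hm)

theorem abs_truncPrim_sub_le (hε : 0 < ε) (t : ℝ) : |truncPrim ε t - t ^ 2 / 2| ≤ 2 * ε * |t| := by
  have h1 : truncPrim ε t - t ^ 2 / 2 = ∫ r in (0 : ℝ)..t, (trunc ε r - r) := by
    rw [intervalIntegral.integral_sub (continuous_trunc.intervalIntegrable _ _)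
      (Continuous.intervalIntegrable (by fun_prop) _ _)]
    simp [truncPrim]
  rw [h1]
  have := intervalIntegral.norm_integral_le_of_norm_le_const (a := 0) (b := t) (C := 2 * ε)
    (f := fun r => trunc ε r - r) (fun r _ => abs_trunc_sub_le hε r)
  simpa using this

end Truncation

section LogConvexity

theorem not_two_sub_le {y z x : ℝ} (hy : 0 ≤ y) (hy1 : y ≤ 1) (hz : 0 < z) (hyz : y ^ 3 ≤ z)
    (hx : y + z ≤ x) : ¬ 2 - y ≤ Real.exp (-x) * (2 + y) := by
  intro h
  have hE : 1 + y + y ^ 2 / 2 + z ≤ Real.exp x := by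
    have h1 := Real.quadratic_le_exp_of_nonneg (add_nonneg hy hz.le)
    have h2 := Real.exp_le_exp.2 hx
    nlinarith [mul_nonneg hy hz.le]
  have hEX : Real.exp x * Real.exp (-x) = 1 := by rw [← Real.exp_add]; simp
  have hfin : (2 - y) * (1 + y + y ^ 2 / 2 + z) ≤ 2 + y := by
    calc (2 - y) * (1 + y + y ^ 2 / 2 + z) ≤ (2 - y) * Real.exp x := by
          apply mul_le_mul_of_nonneg_left hE; linarith
      _ ≤ Real.exp (-x) * (2 + y) * Real.exp x := by gcongr
      _ = (Real.exp x * Real.exp (-x)) * (2 + y) := by ring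
      _ = 2 + y := by rw [hEX, one_mul]
  have h3 : (2 - y) * (1 + y + y ^ 2 / 2 + z) = 2 + y - y ^ 3 / 2 + (2 - y) * z := by ring
  nlinarith [mul_nonneg (sub_nonneg.2 hy1) hz.le]

theorem log_convex_of_pos {f f' : ℝ → ℝ} {a b : ℝ} (hab : a < b)
    (hc : ContinuousOn f (Icc a b)) (hd : ∀ s ∈ Ioo a b, HasDerivAt f (f' s) s)
    (hf' : ∀ s ∈ Ioo a b, 0 ≤ f' s) (hpos : ∀ s ∈ Icc a b, 0 < f s)
    (hineq : ∀ s ∈ Ioo a b, ∀ t ∈ Ico a s, ∀ κ > 0, ∀ η > 0,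
      f s ≤ (κ * f s + f t / κ) / 2 + (η * (s - t) * f' s + (f s - f t) / η) / 4) :
    f ((a + 2 * b) / 3) ^ 3 ≤ f a * f b ^ 2 := by
  set m := (a + 2 * b) / 3 with hm
  have ham : a < m := by rw [hm]; linarith
  have hmb : m < b := by rw [hm]; linarith
  set q : ℝ → ℝ := fun s => Real.log (f s) / 2 with hq
  by_contra! hcon
  have hfa := hpos a (left_mem_Icc.2 hab.le)
  have hfb := hpos b (right_mem_Icc.2 hab.le)
  have hfm := hpos m ⟨ham.le, hmb.le⟩
  have hgap : q a + 2 * q b < 3 * q m := by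
    have := Real.log_lt_log (by positivity) hcon
    rw [Real.log_mul (by positivity) (by positivity), Real.log_pow, Real.log_pow] at this
    simp only [hq]
    push_cast at this
    linarith
  set L := (q b - q a) / (b - a) with hL
  have hLe : L * (b - a) = q b - q a := div_mul_cancel₀ _ (by linarith)
  obtain ⟨e, he, hepos⟩ : ∃ e > 0, 0 < q m - (q a + L * (m - a)) + e * ((m - a) * (m - b)) := by
    have h1 : 0 < q m - (q a + L * (m - a)) := by
      have : L * (m - a) = 2 / 3 * (q b - q a) := by rw [← hLe, hm]; ring
      rw [this]; linarith
    set G := q m - (q a + L * (m - a))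
    have h2 : 0 < (m - a) * (b - m) := mul_pos (by linarith) (by linarith)
    refine ⟨G / (2 * ((m - a) * (b - m))), by positivity, ?_⟩
    have : G / (2 * ((m - a) * (b - m))) * ((m - a) * (m - b)) = -(G / 2) := by
      have h3 : b - m ≠ 0 := by linarith
      have h4 : m - a ≠ 0 := by linarith
      field_simp
      ring
    rw [this]; linarith
  set ψ : ℝ → ℝ := fun s => q s - (q a + L * (s - a)) + e * ((s - a) * (s - b)) with hψ
  have hψc : ContinuousOn ψ (Icc a b) := by
    have : ContinuousOn q (Icc a b) := (hc.log fun s hs => (hpos s hs).ne').div_const 2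
    fun_prop
  obtain ⟨s, hs, hmax⟩ := isCompact_Icc.exists_isMaxOn ⟨m, ham.le, hmb.le⟩ hψc
  have hψs : 0 < ψ s := hepos.trans_le (hmax ⟨ham.le, hmb.le⟩)
  have hsa : a < s := lt_of_le_of_ne hs.1 fun h => by
    rw [← h] at hψs; simp [hψ] at hψs
  have hsb : s < b := lt_of_le_of_ne hs.2 fun h => by
    rw [h] at hψs; simp [hψ, hLe] at hψs
  have hsI : s ∈ Ioo a b := ⟨hsa, hsb⟩
  have hfs := hpos s hs
  set c := f' s / f s / 2 with hcdef
  have hc0 : 0 ≤ c := by have := hf' s hsI; positivity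
  have hder : HasDerivAt ψ (c - L + e * ((s - b) + (s - a))) s := by
    have h1 : HasDerivAt q c s := ((hd s hsI).log hfs.ne').div_const 2
    have h2 : HasDerivAt (fun s => q a + L * (s - a)) L s := by
      simpa using (((hasDerivAt_id s).sub_const a).const_mul L).const_add (q a)
    have h3 : HasDerivAt (fun s => e * ((s - a) * (s - b))) (e * ((s - b) + (s - a))) s := by
      simpa using (((hasDerivAt_id s).sub_const a).fun_mul
        ((hasDerivAt_id s).sub_const b)).const_mul e
    exact (h1.sub h2).add h3
  have hzero : c - L + e * ((s - b) + (s - a)) = 0 :=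
    (hmax.isLocalMax (Icc_mem_nhds hsa hsb)).hasDerivAt_eq_zero hder
  obtain ⟨δ, hδ, hδ1, hδ2, hδ3⟩ : ∃ δ > 0, δ ≤ s - a ∧ c * δ ≤ 1 ∧ c ^ 3 * δ ≤ e := by
    refine ⟨min (s - a) (min (1 / (c + 1)) (e / (c ^ 3 + 1))), ?_, min_le_left _ _, ?_, ?_⟩
    · exact lt_min (by linarith) (lt_min (by positivity) (by positivity))
    · calc c * _ ≤ c * (1 / (c + 1)) := by
            gcongr; exact (min_le_right _ _).trans (min_le_left _ _)
        _ ≤ 1 := by rw [mul_one_div, div_le_one (by positivity)]; linarith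
    · calc c ^ 3 * _ ≤ c ^ 3 * (e / (c ^ 3 + 1)) := by
            gcongr; exact (min_le_right _ _).trans (min_le_right _ _)
        _ ≤ e := by
            rw [mul_div_assoc', div_le_iff₀ (by positivity)]
            nlinarith [pow_nonneg hc0 3]
  set t := s - δ with ht
  have htI : t ∈ Ico a s := ⟨by rw [ht]; linarith, by rw [ht]; linarith⟩
  have htm : ψ t ≤ ψ s := hmax ⟨htI.1, htI.2.le.trans hs.2⟩
  have hft := hpos t ⟨htI.1, htI.2.le.trans hs.2⟩
  have hqd : c * δ + e * δ ^ 2 ≤ q s - q t := by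
    have h1 : L = c + e * ((s - b) + (s - a)) := by linarith
    simp only [hψ] at htm
    rw [h1, ht] at htm
    rw [ht]
    nlinarith [htm]
  set X := Real.exp (q t - q s) with hX
  have hX2 : f t = f s * X ^ 2 := by
    have : X ^ 2 = f t / f s := by
      rw [hX, ← Real.exp_nat_mul]
      have : ((2 : ℕ) : ℝ) * (q t - q s) = Real.log (f t) - Real.log (f s) := by
        simp only [hq]; push_cast; ring
      rw [this, Real.exp_sub, Real.exp_log hft, Real.exp_log hfs]
    rw [this]; field_simp
  have hXpos : 0 < X := Real.exp_pos _
  have hkey : 2 - c * δ ≤ X * (2 + c * δ) := by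
    have h := hineq s hsI t htI X hXpos ((1 + X) / 2) (by positivity)
    have h1 : f' s = 2 * c * f s := by rw [hcdef]; field_simp
    have h2 : s - t = δ := by rw [ht]; ring
    rw [hX2, h1, h2] at h
    have h3 : (X * f s + f s * X ^ 2 / X) / 2 + ((1 + X) / 2 * δ * (2 * c * f s) +
        (f s - f s * X ^ 2) / ((1 + X) / 2)) / 4 =
        f s * (X + (1 + X) * (c * δ) / 4 + (1 - X) / 2) := by
      field_simp; ring
    rw [h3] at h
    have h4 : 1 ≤ X + (1 + X) * (c * δ) / 4 + (1 - X) / 2 := by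
      by_contra! h5
      nlinarith
    linarith
  have hXX : X = Real.exp (-(q s - q t)) := by rw [hX]; congr 1; ring
  rw [hXX] at hkey
  refine not_two_sub_le (z := e * δ ^ 2) (by positivity) hδ2 (by positivity) ?_ hqd hkey
  calc (c * δ) ^ 3 = (c ^ 3 * δ) * δ ^ 2 := by ring
    _ ≤ e * δ ^ 2 := by gcongr

theorem log_convex_of_nonneg {f f' : ℝ → ℝ} {a b : ℝ} (hab : a < b)
    (hc : ContinuousOn f (Icc a b)) (hd : ∀ s ∈ Ioo a b, HasDerivAt f (f' s) s)
    (hf' : ∀ s ∈ Ioo a b, 0 ≤ f' s) (hpos : ∀ s ∈ Icc a b, 0 ≤ f s)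
    (hineq : ∀ s ∈ Ioo a b, ∀ t ∈ Ico a s, ∀ κ > 0, ∀ η > 0,
      f s ≤ (κ * f s + f t / κ) / 2 + (η * (s - t) * f' s + (f s - f t) / η) / 4) :
    f ((a + 2 * b) / 3) ^ 3 ≤ f a * f b ^ 2 := by
  have key : ∀ c > 0, (f ((a + 2 * b) / 3) + c) ^ 3 ≤ (f a + c) * (f b + c) ^ 2 := by
    intro c hc0
    refine log_convex_of_pos (f := fun s => f s + c) (f' := f') hab (hc.add continuousOn_const)
      (fun s hs => (hd s hs).add_const c) hf' (fun s hs => by linarith [hpos s hs]) ?_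
    intro s hs t ht κ hκ η hη
    have h1 := hineq s hs t ht κ hκ η hη
    have h2 : c ≤ (κ * c + c / κ) / 2 := by
      have : (κ * c + c / κ) / 2 - c = c * (κ - 1) ^ 2 / (2 * κ) := by field_simp; ring
      have : 0 ≤ c * (κ - 1) ^ 2 / (2 * κ) := by positivity
      linarith
    have h3 : f s + c - (f t + c) = f s - f t := by ring
    simp only [h3, mul_add, add_div]
    simp only [add_div] at h1 h2
    linarith
  have h1 : Filter.Tendsto (fun c : ℝ => (f ((a + 2 * b) / 3) + c) ^ 3)
      (nhdsWithin 0 (Ioi 0)) (nhds ((f ((a + 2 * b) / 3) + 0) ^ 3)) :=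
    (Continuous.tendsto (by fun_prop) 0).mono_left nhdsWithin_le_nhds
  have h2 : Filter.Tendsto (fun c : ℝ => (f a + c) * (f b + c) ^ 2)
      (nhdsWithin 0 (Ioi 0)) (nhds ((f a + 0) * (f b + 0) ^ 2)) :=
    (Continuous.tendsto (by fun_prop) 0).mono_left nhdsWithin_le_nhds
  simpa using le_of_tendsto_of_tendsto h1 h2 (eventually_mem_nhdsWithin.mono key)

end LogConvexity

section Energy

open Filter Topology

variable {d : ℕ} {U U' Ω Ω' : Set (Esp d)} {u v : Esp d → ℝ}

theorem integrable_of_eq_zero_off_compact {P : Set (Esp d)} (hP : IsCompact P) {F : Esp d → ℝ}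
    (hc : ContinuousOn F P) (h0 : ∀ x ∉ P, F x = 0) : Integrable F := by
  refine (integrableOn_iff_integrable_of_support_subset ?_).1 (hc.integrableOn_compact hP)
  intro x hx
  by_contra hn
  exact hx (h0 x hn)

/-- The gradient of a function vanishes almost everywhere on its zero set. -/
theorem ae_formDot_fderiv_eq_zero (hΩ : IsOpen Ω) (hu : ContDiffOn ℝ 1 u Ω) :
    ∀ᵐ x, x ∈ Ω → u x = 0 → formDot (fderiv ℝ u x) (fderiv ℝ u x) = 0 := by
  suffices H : ∀ i : Fin d, ∀ᵐ x, x ∈ Ω → u x = 0 →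
      fderiv ℝ u x (EuclideanSpace.single i 1) = 0 by
    filter_upwards [ae_all_iff.2 H] with x hx hxΩ hx0
    simp [formDot, hx _ hxΩ hx0]
  intro i
  set e : Esp d := EuclideanSpace.single i 1
  have hdu : ContinuousOn (fun x => fderiv ℝ u x e) Ω :=
    (hu.continuousOn_fderiv_of_isOpen hΩ le_rfl).clm_apply continuousOn_const
  have hm : MeasurableSet {x | x ∈ Ω → u x = 0 → fderiv ℝ u x e = 0} := by
    have : {x | x ∈ Ω → u x = 0 → fderiv ℝ u x e = 0} =
        (Ω)ᶜ ∪ (Ω ∩ u ⁻¹' {0}ᶜ) ∪ (Ω ∩ (fun x => fderiv ℝ u x e) ⁻¹' {0}ᶜ)ᶜ := by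
      ext x; simp only [mem_ofPred_eq, mem_union, mem_compl_iff, mem_inter_iff, mem_preimage,
        mem_singleton_iff]; tauto
    rw [this]
    exact (hΩ.measurableSet.compl.union
      (hu.continuousOn.isOpen_inter_preimage hΩ isOpen_compl_singleton).measurableSet).union
      (hdu.isOpen_inter_preimage hΩ isOpen_compl_singleton).measurableSet.compl
  refine ae_mem_of_ae_add_linearMap_mem (LinearMap.toSpanSingleton ℝ (Esp d) e) volume volume hm ?_
  intro y
  set Z : Set ℝ := {t | y + t • e ∈ Ω ∧ u (y + t • e) = 0 ∧ fderiv ℝ u (y + t • e) e ≠ 0}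
  have hZ : Z.Countable := by
    refine (countable_setOfPred_isolated_right_within (s := Z)).mono ?_
    intro t ht
    refine ⟨ht, ?_⟩
    have h1 : HasDerivAt (fun s : ℝ => u (y + s • e)) (fderiv ℝ u (y + t • e) e) t := by
      have h2 : HasFDerivAt u (fderiv ℝ u (y + t • e)) (y + t • e) :=
        (((hu _ ht.1).contDiffAt (hΩ.mem_nhds ht.1)).differentiableAt (by simp)).hasFDerivAt
      have h3 : HasDerivAt (fun s : ℝ => y + s • e) e t := by
        simpa using ((hasDerivAt_id t).smul_const e).const_add y
      exact h2.comp_hasDerivAt t h3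
    have h4 := h1.eventually_ne ht.2.2 (c := 0)
    rw [← empty_mem_iff_bot, mem_nhdsWithin_iff_eventually]
    filter_upwards [eventually_nhdsWithin_iff.1 h4] with s hs hsZ
    exact hs (ne_of_gt hsZ.2) hsZ.1.2.1
  filter_upwards [hZ.ae_notMem volume] with t ht h1 h2
  by_contra h3
  exact ht ⟨h1, h2, h3⟩

namespace HarmonicZeroExt

theorem contDiffAt_two (hu : HarmonicZeroExt U Ω u) {x : Esp d} (hx : x ∈ Ω) :
    ContDiffAt ℝ 2 u x := (hu.smooth x hx).contDiffAt (hu.isOpen_set.mem_nhds hx)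

theorem hasFDerivAt (hu : HarmonicZeroExt U Ω u) {x : Esp d} (hx : x ∈ Ω) :
    HasFDerivAt u (fderiv ℝ u x) x :=
  ((hu.contDiffAt_two hx).differentiableAt (by simp)).hasFDerivAt

theorem continuousOn_fderiv (hu : HarmonicZeroExt U Ω u) : ContinuousOn (fderiv ℝ u) Ω :=
  hu.smooth.continuousOn_fderiv_of_isOpen hu.isOpen_set (by norm_num)

/-- Rescaling. -/
theorem comp_smul (hu : HarmonicZeroExt U Ω u) (c : Esp d) {r : ℝ} :
    HarmonicZeroExt ((fun x => c + r • x) ⁻¹' U) ((fun x => c + r • x) ⁻¹' Ω)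
      (fun x => u (c + r • x)) := by
  have hc : Continuous fun x : Esp d => c + r • x := by fun_prop
  have hs : ContDiff ℝ 2 fun x : Esp d => c + r • x := by fun_prop
  have hd : ∀ x : Esp d, HasFDerivAt (fun x : Esp d => c + r • x)
      (r • ContinuousLinearMap.id ℝ (Esp d)) x := fun x =>
    ((hasFDerivAt_id x).const_smul r).const_add c
  have hΩ := hu.isOpen_set.preimage hc
  refine ⟨hu.isOpen_dom.preimage hc, hΩ, hu.cont.comp hc.continuousOn
    fun x hx => hx, fun x hx => hu.zero _ hx, hu.smooth.comp hs.contDiffOn fun x hx => hx, ?_⟩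
  intro x hx
  have h1 : fderiv ℝ (fun x => u (c + r • x)) =ᶠ[𝓝 x] fun y => r • fderiv ℝ u (c + r • y) := by
    filter_upwards [hΩ.mem_nhds hx] with y hy
    have := ((hu.hasFDerivAt hy).comp y (hd y)).fderiv
    rw [show (fun x => u (c + r • x)) = u ∘ fun x => c + r • x from rfl, this]
    ext z; simp
  have h2 : HasFDerivAt (fderiv ℝ u) (fderiv ℝ (fderiv ℝ u) (c + r • x)) (c + r • x) := by
    have : ContDiffAt ℝ 1 (fderiv ℝ u) (c + r • x) :=
      (hu.contDiffAt_two hx).fderiv_right (by norm_num)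
    exact (this.differentiableAt (by simp)).hasFDerivAt
  have h3 := ((h2.comp x (hd x)).const_smul r).fderiv
  have h4 := hu.lap_eq _ hx
  unfold lap at h4 ⊢
  simp only [iteratedFDeriv_two_apply] at h4 ⊢
  rw [h1.fderiv_eq]
  have h5 : fderiv ℝ (fun y => r • fderiv ℝ u (c + r • y)) x =
      r • (fderiv ℝ (fderiv ℝ u) (c + r • x)).comp (r • ContinuousLinearMap.id ℝ (Esp d)) := h3
  rw [h5]
  simp at h4 ⊢
  simp_rw [← Finset.mul_sum]
  simp [h4]

section Cut

variable {ε : ℝ} {ψ ψ' : ℝ → ℝ}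

theorem hasFDerivAt_comp (hu : HarmonicZeroExt U Ω u) (hε : 0 < ε)
    (hψ : ∀ t, HasDerivAt ψ (ψ' t) t) (h0 : ∀ t, |t| ≤ ε → ψ t = 0) {x : Esp d} (hx : x ∈ U) :
    HasFDerivAt (fun y => ψ (u y)) (ψ' (u x) • fderiv ℝ u x) x := by
  by_cases hxΩ : x ∈ Ω
  · exact (hψ (u x)).comp_hasFDerivAt x (hu.hasFDerivAt hxΩ)
  · have hux := hu.zero x hxΩ
    have h1 : ψ' 0 = 0 := by
      refine (hψ 0).unique ((hasDerivAt_const 0 (0 : ℝ)).congr_of_eventuallyEq ?_)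
      filter_upwards [Ioo_mem_nhds (neg_lt_zero.2 hε) hε] with t ht
      exact h0 t (abs_le.2 ⟨ht.1.le, ht.2.le⟩)
    rw [hux, h1, zero_smul]
    refine (hasFDerivAt_const (0 : ℝ) x).congr_of_eventuallyEq ?_
    have h2 : ContinuousAt u x := hu.cont.continuousAt (hu.isOpen_dom.mem_nhds hx)
    have h3 : ∀ᶠ y in 𝓝 x, u y ∈ Ioo (-ε) ε :=
      h2 (Ioo_mem_nhds (by rw [hux]; linarith) (by rw [hux]; exact hε))
    filter_upwards [h3] with y hy
    exact h0 _ (abs_le.2 ⟨hy.1.le, hy.2.le⟩)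

theorem contDiffOn_comp (hu : HarmonicZeroExt U Ω u) (hε : 0 < ε)
    (hψ : ∀ t, HasDerivAt ψ (ψ' t) t) (hψ' : Continuous ψ') (h0 : ∀ t, |t| ≤ ε → ψ t = 0) :
    ContDiffOn ℝ 1 (fun y => ψ (u y)) U := by
  intro x hx
  refine ContDiffAt.contDiffWithinAt ?_
  by_cases hxΩ : x ∈ Ω
  · exact (contDiff_one_of_hasDerivAt hψ hψ').contDiffAt.comp x
      ((hu.contDiffAt_two hxΩ).of_le (by norm_num))
  · have hux := hu.zero x hxΩ
    refine (contDiffAt_const (c := (0 : ℝ))).congr_of_eventuallyEq ?_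
    have h2 : ContinuousAt u x := hu.cont.continuousAt (hu.isOpen_dom.mem_nhds hx)
    have h3 : ∀ᶠ y in 𝓝 x, u y ∈ Ioo (-ε) ε :=
      h2 (Ioo_mem_nhds (by rw [hux]; linarith) (by rw [hux]; exact hε))
    filter_upwards [h3] with y hy
    exact h0 _ (abs_le.2 ⟨hy.1.le, hy.2.le⟩)

theorem isCompact_superlevel (hu : HarmonicZeroExt U Ω u) (hK : closedBall 0 1 ⊆ U) (ε : ℝ) :
    IsCompact (closedBall (0 : Esp d) 1 ∩ {x | ε ≤ |u x|}) := by
  refine (isCompact_closedBall 0 1).of_isClosed_subset ?_ inter_subset_left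
  exact (hu.cont.mono hK).abs.preimage_isClosed_of_isClosed isClosed_closedBall isClosed_Ici

theorem superlevel_subset (hu : HarmonicZeroExt U Ω u) (hε : 0 < ε) : {x | ε ≤ |u x|} ⊆ Ω := by
  intro x hx
  by_contra hn
  have : ε ≤ |u x| := hx
  rw [hu.zero x hn, abs_zero] at this
  linarith

variable {a : Esp d → ℝ}

theorem tsupport_mul_comp_subset (hu : HarmonicZeroExt U Ω u) (hK : closedBall 0 1 ⊆ U)
    (h0 : ∀ t, |t| ≤ ε → ψ t = 0)
    (ha0 : ∀ x ∉ closedBall (0 : Esp d) 1, a x = 0) :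
    tsupport (fun x => a x * ψ (u x)) ⊆ closedBall 0 1 ∩ {x | ε ≤ |u x|} := by
  refine closure_minimal ?_ (hu.isCompact_superlevel hK ε).isClosed
  intro x hx
  constructor
  · by_contra hn
    exact hx (by simp [ha0 x hn])
  · by_contra hn
    exact hx (by simp [h0 _ (not_le.1 hn).le])

theorem contDiff_mul_comp (hu : HarmonicZeroExt U Ω u) (hK : closedBall 0 1 ⊆ U) (hε : 0 < ε)
    (hψ : ∀ t, HasDerivAt ψ (ψ' t) t) (hψ' : Continuous ψ') (h0 : ∀ t, |t| ≤ ε → ψ t = 0)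
    (ha : ContDiff ℝ 1 a) (ha0 : ∀ x ∉ closedBall (0 : Esp d) 1, a x = 0) :
    ContDiff ℝ 1 (fun x => a x * ψ (u x)) :=
  contDiff_of_tsupport_subset hu.isOpen_dom
    (ha.contDiffOn.mul (hu.contDiffOn_comp hε hψ hψ' h0))
    (((hu.tsupport_mul_comp_subset hK h0 ha0).trans inter_subset_left).trans hK)

theorem fderiv_mul_comp (hu : HarmonicZeroExt U Ω u) (hK : closedBall 0 1 ⊆ U) (hε : 0 < ε)
    (hψ : ∀ t, HasDerivAt ψ (ψ' t) t) (h0 : ∀ t, |t| ≤ ε → ψ t = 0)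
    (ha : ContDiff ℝ 1 a) (ha0 : ∀ x ∉ closedBall (0 : Esp d) 1, a x = 0) (x : Esp d) :
    fderiv ℝ (fun x => a x * ψ (u x)) x =
      (a x * ψ' (u x)) • fderiv ℝ u x + ψ (u x) • fderiv ℝ a x := by
  by_cases hx : x ∈ closedBall (0 : Esp d) 1
  · rw [((ha.differentiable (by simp) x).hasFDerivAt.fun_mul
      (hu.hasFDerivAt_comp hε hψ h0 (hK hx))).fderiv, smul_smul]
  · have h1 : a =ᶠ[𝓝 x] 0 := by
      filter_upwards [isClosed_closedBall.isOpen_compl.mem_nhds hx] with y hy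
      exact ha0 y hy
    have h2 : (fun x => a x * ψ (u x)) =ᶠ[𝓝 x] 0 := by
      filter_upwards [h1] with y hy
      simp [hy]
    simp [h1.fderiv_eq, h2.fderiv_eq, ha0 x hx]

end Cut

variable {ε : ℝ}

theorem integrable_cutSlope (hu : HarmonicZeroExt U Ω u) (hK : closedBall 0 1 ⊆ U) (hε : 0 < ε)
    {A B : Esp d → Esp d →L[ℝ] ℝ} (hA : ContinuousOn A (closedBall 0 1 ∩ Ω))
    (hB : ContinuousOn B (closedBall 0 1 ∩ Ω)) :
    Integrable fun x => wtPot x * cutSlope ε (u x) * formDot (A x) (B x) := by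
  refine integrable_of_eq_zero_off_compact (hu.isCompact_superlevel hK ε) ?_ ?_
  · have hs : closedBall 0 1 ∩ {x | ε ≤ |u x|} ⊆ closedBall 0 1 ∩ Ω :=
      inter_subset_inter_right _ (hu.superlevel_subset hε)
    have h1 : ContinuousOn (fun x => formDot (A x) (B x)) (closedBall 0 1 ∩ {x | ε ≤ |u x|}) :=
      continuous_formDot.comp_continuousOn ((hA.mono hs).prodMk (hB.mono hs))
    exact (continuous_wtPot.continuousOn.mul (continuous_cutSlope.comp_continuousOn
      (hu.cont.mono (inter_subset_left.trans hK)))).mul h1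
  · intro x hx
    by_cases hx1 : x ∈ closedBall (0 : Esp d) 1
    · have : ¬ ε ≤ |u x| := fun h => hx ⟨hx1, h⟩
      simp [cutSlope_eq_zero hε (not_le.1 this).le]
    · simp [wtPot_eq_zero hx1]

theorem integrable_trunc_mul (hu : HarmonicZeroExt U Ω u) (hK : closedBall 0 1 ⊆ U) (hε : 0 < ε)
    {b : Esp d → ℝ} (hb : ContinuousOn b (closedBall 0 1 ∩ Ω)) :
    Integrable fun x => wt x * trunc ε (u x) * b x := by
  refine integrable_of_eq_zero_off_compact (hu.isCompact_superlevel hK ε) ?_ ?_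
  · have hs : closedBall 0 1 ∩ {x | ε ≤ |u x|} ⊆ closedBall 0 1 ∩ Ω :=
      inter_subset_inter_right _ (hu.superlevel_subset hε)
    exact (continuous_wt.continuousOn.mul (continuous_trunc.comp_continuousOn
      (hu.cont.mono (inter_subset_left.trans hK)))).mul (hb.mono hs)
  · intro x hx
    by_cases hx1 : x ∈ closedBall (0 : Esp d) 1
    · have : ¬ ε ≤ |u x| := fun h => hx ⟨hx1, h⟩
      simp [trunc_eq_zero hε (not_le.1 this).le]
    · simp [wt_eq_zero hx1]

theorem integral_trunc_fderiv (hu : HarmonicZeroExt U Ω u) (hK : closedBall 0 1 ⊆ U)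
    (hε : 0 < ε) (hv : HarmonicZeroExt U' Ω' v) (hΩ : closedBall 0 1 ∩ Ω ⊆ Ω') :
    ∫ x, wt x * trunc ε (u x) * fderiv ℝ v x x =
      ∫ x, wtPot x * cutSlope ε (u x) * formDot (fderiv ℝ u x) (fderiv ℝ v x) := by
  have hs : closedBall 0 1 ∩ {x | ε ≤ |u x|} ⊆ closedBall 0 1 ∩ Ω :=
    inter_subset_inter_right _ (hu.superlevel_subset hε)
  have h0 : ∀ t, |t| ≤ ε → trunc ε t = 0 := fun t => trunc_eq_zero hε
  have ht := hu.tsupport_mul_comp_subset (ψ := trunc ε) (a := wtPot) hK h0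
    fun x hx => wtPot_eq_zero hx
  have hi := integral_formDot_eq_zero hv.isOpen_set
    (hu.contDiff_mul_comp hK hε hasDerivAt_trunc continuous_cutSlope h0 contDiff_wtPot
      fun x hx => wtPot_eq_zero hx)
    ((hu.isCompact_superlevel hK ε).of_isClosed_subset (isClosed_tsupport _) ht)
    ((ht.trans hs).trans hΩ) hv.smooth hv.lap_eq
  have hpt : ∀ x, formDot (fderiv ℝ (fun x => wtPot x * trunc ε (u x)) x) (fderiv ℝ v x) =
      wtPot x * cutSlope ε (u x) * formDot (fderiv ℝ u x) (fderiv ℝ v x) -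
        wt x * trunc ε (u x) * fderiv ℝ v x x := by
    intro x
    rw [hu.fderiv_mul_comp hK hε hasDerivAt_trunc h0 contDiff_wtPot
      (fun x hx => wtPot_eq_zero hx) x, formDot_add_left, formDot_smul_left, formDot_smul_left,
      (hasFDerivAt_wtPot x).fderiv, formDot_smul_left, formDot_innerSL]
    ring
  simp_rw [hpt] at hi
  rw [integral_sub, sub_eq_zero] at hi
  · exact hi.symm
  · exact hu.integrable_cutSlope hK hε (hu.continuousOn_fderiv.mono inter_subset_right)
      (hv.continuousOn_fderiv.mono hΩ)
  · exact hu.integrable_trunc_mul hK hε ((hv.continuousOn_fderiv.mono hΩ).clm_apply continuousOn_id)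

theorem integral_cutSlope_eq (hu : HarmonicZeroExt U Ω u) (hK : closedBall 0 1 ⊆ U)
    (hε : 0 < ε) :
    ∫ x, wtPot x * cutSlope ε (u x) * formDot (fderiv ℝ u x) (fderiv ℝ u x) =
      ∫ x, wtDiv x * truncPrim ε (u x) := by
  rw [← hu.integral_trunc_fderiv hK hε hu inter_subset_right]
  have h0 : ∀ t, |t| ≤ ε → truncPrim ε t = 0 := fun t => truncPrim_eq_zero hε
  have ht := hu.tsupport_mul_comp_subset (ψ := truncPrim ε) (a := wt) hK h0
    fun x hx => wt_eq_zero hx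
  have hi := integral_radial_eq
    (hu.contDiff_mul_comp hK hε hasDerivAt_truncPrim continuous_trunc h0 contDiff_wt
      fun x hx => wt_eq_zero hx)
    ((hu.isCompact_superlevel hK ε).of_isClosed_subset (isClosed_tsupport _) ht)
  have hpt : ∀ x, fderiv ℝ (fun x => wt x * truncPrim ε (u x)) x x +
      d * (wt x * truncPrim ε (u x)) =
      wt x * trunc ε (u x) * fderiv ℝ u x x - wtDiv x * truncPrim ε (u x) := by
    intro x
    rw [hu.fderiv_mul_comp hK hε hasDerivAt_truncPrim h0 contDiff_wt
      (fun x hx => wt_eq_zero hx) x]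
    simp only [add_apply, smul_apply, smul_eq_mul,
      fderiv_wt_apply_self]
    ring
  simp_rw [hpt] at hi
  rw [integral_sub, sub_eq_zero] at hi
  · exact hi
  · exact hu.integrable_trunc_mul hK hε
      ((hu.continuousOn_fderiv.mono inter_subset_right).clm_apply continuousOn_id)
  · exact integrable_weight_mul continuous_wtDiv (fun x hx => wtDiv_eq_zero hx)
      (continuous_truncPrim.comp_continuousOn (hu.cont.mono hK))

end HarmonicZeroExt

end Energy

section EnergyBounds

open Filter Topology

variable {d : ℕ} {U U' Ω Ω' : Set (Esp d)} {u v : Esp d → ℝ}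

/-- A sequence of truncation levels decreasing to zero. -/
theorem tendsto_one_div_add_one_zero : Tendsto (fun n : ℕ => 1 / ((n : ℝ) + 1)) atTop (𝓝 0) :=
  tendsto_one_div_add_atTop_nhds_zero_nat

namespace HarmonicZeroExt

theorem abs_integral_truncPrim_sub_le (hu : HarmonicZeroExt U Ω u) (hK : closedBall 0 1 ⊆ U)
    {ε : ℝ} (hε : 0 < ε) :
    |(∫ x, wtDiv x * truncPrim ε (u x)) - (∫ x, wtDiv x * (u x) ^ 2) / 2| ≤
      ε * (2 * ∫ x, |wtDiv x| * |u x|) := by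
  have huK := hu.cont.mono hK
  have h1 : Integrable fun x => wtDiv x * truncPrim ε (u x) :=
    integrable_weight_mul continuous_wtDiv (fun x hx => wtDiv_eq_zero hx)
    ((continuous_truncPrim (ε := ε)).comp_continuousOn huK)
  have h2 : Integrable fun x => wtDiv x * (u x) ^ 2 :=
    integrable_weight_mul continuous_wtDiv (fun x hx => wtDiv_eq_zero hx) (huK.pow 2)
  have h3 := integrable_weight_mul (continuous_wtDiv (d := d)).abs
    (fun x hx => by rw [wtDiv_eq_zero hx, abs_zero]) huK.abs
  rw [← integral_div, ← integral_sub h1 (h2.div_const 2), ← integral_const_mul,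
    ← integral_const_mul]
  refine (abs_integral_le_integral_abs).trans (integral_mono (h1.sub (h2.div_const 2)).abs
    ((h3.const_mul 2).const_mul ε) fun x => ?_)
  have h4 : wtDiv x * truncPrim ε (u x) - wtDiv x * (u x) ^ 2 / 2 =
      wtDiv x * (truncPrim ε (u x) - (u x) ^ 2 / 2) := by ring
  have h5 := abs_truncPrim_sub_le hε (u x)
  calc _ = |wtDiv x| * |truncPrim ε (u x) - (u x) ^ 2 / 2| := by rw [← abs_mul, ← h4]
    _ ≤ |wtDiv x| * (2 * ε * |u x|) := by gcongr
    _ = _ := by ring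

theorem tendsto_integral_truncPrim (hu : HarmonicZeroExt U Ω u) (hK : closedBall 0 1 ⊆ U) :
    Tendsto (fun n : ℕ => ∫ x, wtDiv x * truncPrim (1 / ((n : ℝ) + 1)) (u x)) atTop
      (𝓝 ((∫ x, wtDiv x * (u x) ^ 2) / 2)) := by
  rw [tendsto_iff_dist_tendsto_zero]
  have h1 := (tendsto_one_div_add_one_zero).mul_const (2 * ∫ x, |wtDiv x| * |u x|)
  rw [zero_mul] at h1
  exact squeeze_zero (fun _ => dist_nonneg)
    (fun n => hu.abs_integral_truncPrim_sub_le hK Nat.one_div_pos_of_nat) h1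

theorem integral_wtDiv_nonneg (hu : HarmonicZeroExt U Ω u) (hK : closedBall 0 1 ⊆ U) :
    0 ≤ ∫ x, wtDiv x * (u x) ^ 2 := by
  have h := ge_of_tendsto' (hu.tendsto_integral_truncPrim hK) (b := 0) fun n => by
    rw [← hu.integral_cutSlope_eq hK (by positivity)]
    exact integral_nonneg fun x => mul_nonneg (mul_nonneg (wtPot_nonneg x) (cutSlope_nonneg _))
      (formDot_self_nonneg _)
  linarith

/-- The weighted Dirichlet energy is controlled by a boundary-type term. -/
theorem lintegral_energy_le (hu : HarmonicZeroExt U Ω u) (hK : closedBall 0 1 ⊆ U) :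
    ∫⁻ x in Ω, ENNReal.ofReal (wtPot x * formDot (fderiv ℝ u x) (fderiv ℝ u x)) ≤
      ENNReal.ofReal ((∫ x, wtDiv x * (u x) ^ 2) / 2) := by
  set F : ℕ → Esp d → ℝ := fun n x =>
    wtPot x * cutSlope (1 / ((n : ℝ) + 1)) (u x) * formDot (fderiv ℝ u x) (fderiv ℝ u x)
  have hFi : ∀ n, Integrable (F n) := fun n =>
    hu.integrable_cutSlope hK (by positivity) (hu.continuousOn_fderiv.mono inter_subset_right)
      (hu.continuousOn_fderiv.mono inter_subset_right)
  have hF0 : ∀ n x, 0 ≤ F n x := fun n x =>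
    mul_nonneg (mul_nonneg (wtPot_nonneg x) (cutSlope_nonneg _)) (formDot_self_nonneg _)
  calc ∫⁻ x in Ω, ENNReal.ofReal (wtPot x * formDot (fderiv ℝ u x) (fderiv ℝ u x))
      ≤ ∫⁻ x in Ω, liminf (fun n => ENNReal.ofReal (F n x)) atTop := by
        refine lintegral_mono_ae ?_
        rw [ae_restrict_iff' hu.isOpen_set.measurableSet]
        filter_upwards [ae_formDot_fderiv_eq_zero hu.isOpen_set (hu.smooth.of_le (by norm_num))]
          with x hx hxΩ
        by_cases h0 : u x = 0
        · simp [hx hxΩ h0]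
        · refine le_liminf_of_le (by isBoundedDefault) ?_
          have h1 : ∀ᶠ n : ℕ in atTop, 1 / ((n : ℝ) + 1) < |u x| / 2 :=
            tendsto_one_div_add_one_zero.eventually_lt_const (by positivity)
          filter_upwards [h1] with n hn
          simp only [F]
          rw [cutSlope_eq_one (by positivity) (by linarith), mul_one]
    _ ≤ liminf (fun n => ∫⁻ x in Ω, ENNReal.ofReal (F n x)) atTop :=
        lintegral_liminf_le' fun n =>
          (hFi n).aestronglyMeasurable.aemeasurable.ennreal_ofReal.restrict
    _ ≤ liminf (fun n : ℕ => ENNReal.ofReal (∫ x, wtDiv x * truncPrim (1 / ((n : ℝ) + 1)) (u x)))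
          atTop := by
        refine liminf_le_liminf (Eventually.of_forall fun n => ?_)
        rw [← hu.integral_cutSlope_eq hK (by positivity),
          ofReal_integral_eq_lintegral_ofReal (hFi n) (Eventually.of_forall (hF0 n))]
        exact setLIntegral_le_lintegral _ _
    _ = _ := ((ENNReal.continuous_ofReal.tendsto _).comp
        (hu.tendsto_integral_truncPrim hK)).liminf_eq

theorem integral_cutSlope_energy_le (hu : HarmonicZeroExt U Ω u) (hK : closedBall 0 1 ⊆ U)
    (hv : HarmonicZeroExt U' Ω' v) (hK' : closedBall 0 1 ⊆ U') (hΩ : closedBall 0 1 ∩ Ω ⊆ Ω')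
    {ε : ℝ} (hε : 0 < ε) :
    ∫ x, wtPot x * cutSlope ε (u x) * formDot (fderiv ℝ v x) (fderiv ℝ v x) ≤
      (∫ x, wtDiv x * (v x) ^ 2) / 2 := by
  have hi := hu.integrable_cutSlope hK hε (hv.continuousOn_fderiv.mono hΩ)
    (hv.continuousOn_fderiv.mono hΩ)
  have h0 : ∀ x, 0 ≤ wtPot x * cutSlope ε (u x) * formDot (fderiv ℝ v x) (fderiv ℝ v x) :=
    fun x => mul_nonneg (mul_nonneg (wtPot_nonneg x) (cutSlope_nonneg _)) (formDot_self_nonneg _)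
  rw [← ENNReal.ofReal_le_ofReal_iff (by linarith [hv.integral_wtDiv_nonneg hK']),
    ofReal_integral_eq_lintegral_ofReal hi (Eventually.of_forall h0)]
  refine le_trans ?_ (hv.lintegral_energy_le hK')
  rw [← lintegral_indicator hv.isOpen_set.measurableSet]
  refine lintegral_mono fun x => ?_
  by_cases hx : x ∈ Ω'
  · rw [indicator_of_mem hx]
    refine ENNReal.ofReal_le_ofReal (mul_le_mul_of_nonneg_right ?_ (formDot_self_nonneg _))
    exact mul_le_of_le_one_right (wtPot_nonneg x) (cutSlope_le_one _)
  · have : wtPot x * cutSlope ε (u x) = 0 := by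
      by_cases hx1 : x ∈ closedBall (0 : Esp d) 1
      · have h2 : u x = 0 := hu.zero x fun h => hx (hΩ ⟨hx1, h⟩)
        rw [h2, cutSlope_eq_zero hε (by simp [hε.le]), mul_zero]
      · rw [wtPot_eq_zero hx1, zero_mul]
    simp [this]

theorem integral_trunc_fderiv_le (hu : HarmonicZeroExt U Ω u) (hK : closedBall 0 1 ⊆ U)
    (hv : HarmonicZeroExt U' Ω' v) (hK' : closedBall 0 1 ⊆ U') (hΩ : closedBall 0 1 ∩ Ω ⊆ Ω')
    {ε : ℝ} (hε : 0 < ε) {η : ℝ} (hη : 0 < η) :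
    ∫ x, wt x * trunc ε (u x) * fderiv ℝ v x x ≤
      (η * (∫ x, wtDiv x * (u x) ^ 2) + (∫ x, wtDiv x * (v x) ^ 2) / η) / 4 := by
  rw [hu.integral_trunc_fderiv hK hε hv hΩ]
  have h1 := hu.integral_cutSlope_energy_le hK hu hK inter_subset_right hε
  have h2 := hu.integral_cutSlope_energy_le hK hv hK' hΩ hε
  have hdu := hu.continuousOn_fderiv.mono (inter_subset_right (s := closedBall (0 : Esp d) 1))
  have hdv := hv.continuousOn_fderiv.mono hΩ
  have i1 := hu.integrable_cutSlope hK hε hdu hdu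
  have i2 := hu.integrable_cutSlope hK hε hdv hdv
  have i3 := hu.integrable_cutSlope hK hε hdu hdv
  calc _ ≤ ∫ x, (η * (wtPot x * cutSlope ε (u x) * formDot (fderiv ℝ u x) (fderiv ℝ u x)) +
        (wtPot x * cutSlope ε (u x) * formDot (fderiv ℝ v x) (fderiv ℝ v x)) / η) / 2 := by
        refine integral_mono i3 (((i1.const_mul η).add (i2.div_const η)).div_const 2) fun x => ?_
        have h3 : 0 ≤ wtPot x * cutSlope ε (u x) :=
          mul_nonneg (wtPot_nonneg x) (cutSlope_nonneg _)
        refine (mul_le_mul_of_nonneg_left (formDot_le (fderiv ℝ u x) (fderiv ℝ v x) hη) h3).trans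
          (le_of_eq ?_)
        ring
    _ = (η * (∫ x, wtPot x * cutSlope ε (u x) * formDot (fderiv ℝ u x) (fderiv ℝ u x)) +
        (∫ x, wtPot x * cutSlope ε (u x) * formDot (fderiv ℝ v x) (fderiv ℝ v x)) / η) / 2 := by
        rw [integral_div, integral_add (i1.const_mul η) (i2.div_const η), integral_const_mul,
          integral_div]
    _ ≤ (η * ((∫ x, wtDiv x * (u x) ^ 2) / 2) + ((∫ x, wtDiv x * (v x) ^ 2) / 2) / η) / 2 := by
        gcongr
    _ = _ := by ring

end HarmonicZeroExt

end EnergyBounds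

section RadialAverage

open Filter Topology Module

variable {d : ℕ} {w : Esp d → ℝ} {c : Esp d}

theorem continuousOn_comp_scale {U : Set (Esp d)} (hw : ContinuousOn w U) {r r₁ : ℝ}
    (hr0 : 0 ≤ r) (hr : r ≤ r₁) (hU : closedBall c r₁ ⊆ U) :
    ContinuousOn (fun x => w (c + r • x)) (closedBall 0 1) := by
  refine hw.comp (by fun_prop) fun x hx => hU ?_
  rw [mem_closedBall_zero_iff] at hx
  simp only [mem_closedBall, dist_self_add_left, norm_smul, Real.norm_eq_abs, abs_of_nonneg hr0]
  nlinarith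

theorem integral_comp_exp_smul (a : Esp d → ℝ) (s : ℝ) :
    ∫ x, a x * w (c + Real.exp s • x) =
      ∫ z, Real.exp (-(d * s)) * a (Real.exp (-s) • z) * w (c + z) := by
  have h := Measure.integral_comp_smul (volume : Measure (Esp d))
    (fun z => a (Real.exp (-s) • z) * w (c + z)) (Real.exp s)
  simp only [smul_smul, ← Real.exp_add, neg_add_cancel, Real.exp_zero, one_smul] at h
  rw [h, smul_eq_mul, ← integral_const_mul]
  congr 1
  ext z
  have : |(Real.exp s ^ finrank ℝ (Esp d))⁻¹| = Real.exp (-(d * s)) := by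
    rw [abs_of_pos (by positivity), finrank_euclideanSpace_fin, ← Real.exp_nat_mul, Real.exp_neg]
  rw [this]; ring

theorem hasDerivAt_exp_mul_wt (z : Esp d) (s : ℝ) :
    HasDerivAt (fun s => Real.exp (-(d * s)) * wt (Real.exp (-s) • z))
      (Real.exp (-(d * s)) * wtDiv (Real.exp (-s) • z)) s := by
  have h1 : HasDerivAt (fun s : ℝ => Real.exp (-(d * s))) (Real.exp (-(d * s)) * (-d)) s := by
    have : HasDerivAt (fun s : ℝ => -((d : ℝ) * s)) (-d) s := by
      simpa using ((hasDerivAt_id s).const_mul (d : ℝ)).fun_neg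
    exact this.exp
  have h2 : HasDerivAt (fun s : ℝ => Real.exp (-s) • z) (-(Real.exp (-s) • z)) s := by
    simpa using ((hasDerivAt_neg s).exp).smul_const z
  have h3 : HasFDerivAt wt (fderiv ℝ wt (Real.exp (-s) • z)) (Real.exp (-s) • z) :=
    (contDiff_wt.differentiable (by simp) _).hasFDerivAt
  refine (h1.fun_mul (h3.comp_hasDerivAt s h2)).congr_deriv ?_
  rw [map_neg, fderiv_wt_apply_self]
  simp only [Function.comp_apply]
  ring

/-- The derivative of the weighted average over balls in the logarithm of the radius. -/
theorem hasDerivAt_integral_wt {U : Set (Esp d)} (hw : ContinuousOn w U) {s s₁ : ℝ} (hs : s < s₁)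
    (hU : closedBall c (Real.exp s₁) ⊆ U) :
    HasDerivAt (fun s => ∫ x, wt x * w (c + Real.exp s • x))
      (∫ x, wtDiv x * w (c + Real.exp s • x)) s := by
  simp_rw [integral_comp_exp_smul]
  set P : Set (Esp d) := closedBall 0 (Real.exp s₁)
  have hP : IsCompact P := isCompact_closedBall _ _
  have hwP : ContinuousOn (fun z => w (c + z)) P :=
    hw.comp (by fun_prop) fun z hz => hU (by simpa [P] using hz)
  have hoff : ∀ σ < s₁, ∀ z ∉ P, Real.exp (-σ) • z ∉ closedBall (0 : Esp d) 1 := by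
    intro σ hσ z hz
    simp only [P, mem_closedBall_zero_iff, not_le] at hz
    rw [mem_closedBall_zero_iff, not_le, norm_smul, Real.norm_eq_abs, Real.abs_exp]
    calc 1 = Real.exp (-σ) * Real.exp σ := by rw [← Real.exp_add]; simp
      _ < Real.exp (-σ) * ‖z‖ := by gcongr; exact (Real.exp_lt_exp.2 hσ).trans hz
  have hint : ∀ {a : Esp d → ℝ}, Continuous a → (∀ x ∉ closedBall (0 : Esp d) 1, a x = 0) →
      ∀ σ < s₁, Integrable fun z => Real.exp (-(d * σ)) * a (Real.exp (-σ) • z) * w (c + z) := by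
    intro a ha ha0 σ hσ
    refine integrable_of_eq_zero_off_compact hP ?_ ?_
    · exact (Continuous.continuousOn (by fun_prop)).mul hwP
    · intro z hz
      simp [ha0 _ (hoff σ hσ z hz)]
  obtain ⟨C, hC0, hC⟩ := exists_abs_le_of_eq_zero (continuous_wtDiv (d := d))
    fun x hx => wtDiv_eq_zero hx
  refine (hasDerivAt_integral_of_dominated_loc_of_deriv_le
    (bound := P.indicator fun z => Real.exp (d * (1 - s)) * C * |w (c + z)|)
    (s := Ioo (s - 1) s₁)
    (F' := fun σ z => Real.exp (-(d * σ)) * wtDiv (Real.exp (-σ) • z) * w (c + z))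
    (Ioo_mem_nhds (by linarith) hs) ?_ (hint continuous_wt (fun x hx => wt_eq_zero hx) s hs)
    (hint continuous_wtDiv (fun x hx => wtDiv_eq_zero hx) s hs).aestronglyMeasurable
    ?_ ?_ ?_).2
  · filter_upwards [Iio_mem_nhds hs] with σ hσ
    exact (hint continuous_wt (fun x hx => wt_eq_zero hx) σ hσ).aestronglyMeasurable
  · refine Eventually.of_forall fun z σ hσ => ?_
    by_cases hz : z ∈ P
    · rw [indicator_of_mem hz, norm_mul, norm_mul, Real.norm_eq_abs, Real.norm_eq_abs,
        Real.norm_eq_abs, Real.abs_exp]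
      have h1 : -(d * σ) ≤ d * (1 - s) := by
        have : (0 : ℝ) ≤ d := Nat.cast_nonneg d
        nlinarith [hσ.1]
      gcongr
      exact hC _
    · simp [wtDiv_eq_zero (hoff σ hσ.2 z hz), hz]
  · rw [integrable_indicator_iff hP.measurableSet]
    exact (continuousOn_const.mul hwP.abs).integrableOn_compact hP
  · refine Eventually.of_forall fun z σ _ => ?_
    exact (hasDerivAt_exp_mul_wt z σ).mul_const _

end RadialAverage

namespace HarmonicZeroExt

open Filter Topology

variable {d : ℕ} {U Ω : Set (Esp d)} {u : Esp d → ℝ} {c : Esp d}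

theorem closedBall_subset_preimage {r r₁ : ℝ} (hr0 : 0 ≤ r) (hr : r ≤ r₁)
    (hU : closedBall c r₁ ⊆ U) :
    closedBall (0 : Esp d) 1 ⊆ (fun x => c + r • x) ⁻¹' U := by
  intro x hx
  refine hU ?_
  rw [mem_closedBall_zero_iff] at hx
  simp only [mem_closedBall, dist_self_add_left, norm_smul, Real.norm_eq_abs, abs_of_nonneg hr0]
  nlinarith

theorem hasDerivAt_average (hu : HarmonicZeroExt U Ω u) {s s₁ : ℝ} (hs : s < s₁)
    (hU : closedBall c (Real.exp s₁) ⊆ U) :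
    HasDerivAt (fun s => ∫ x, wt x * u (c + Real.exp s • x) ^ 2)
      (∫ x, wtDiv x * u (c + Real.exp s • x) ^ 2) s :=
  hasDerivAt_integral_wt (w := fun x => u x ^ 2) (hu.cont.pow 2) hs hU

theorem average_deriv_nonneg (hu : HarmonicZeroExt U Ω u) {s s₁ : ℝ} (hs : s ≤ s₁)
    (hU : closedBall c (Real.exp s₁) ⊆ U) :
    0 ≤ ∫ x, wtDiv x * u (c + Real.exp s • x) ^ 2 :=
  (hu.comp_smul c).integral_wtDiv_nonneg
    (closedBall_subset_preimage (Real.exp_pos s).le (Real.exp_le_exp.2 hs) hU)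

theorem average_mono (hu : HarmonicZeroExt U Ω u) {s₁ : ℝ}
    (hU : closedBall c (Real.exp s₁) ⊆ U) :
    MonotoneOn (fun s => ∫ x, wt x * u (c + Real.exp s • x) ^ 2) (Iio s₁) := by
  refine monotoneOn_of_deriv_nonneg (convex_Iio s₁)
    (fun s hs => (hu.hasDerivAt_average hs hU).continuousAt.continuousWithinAt)
    (fun s hs => (hu.hasDerivAt_average (mem_Iio.1 (interior_subset hs))
      hU).differentiableAt.differentiableWithinAt)
    fun s hs => ?_
  have hs' : s < s₁ := mem_Iio.1 (interior_subset hs)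
  rw [(hu.hasDerivAt_average hs' hU).deriv]
  exact hu.average_deriv_nonneg hs'.le hU

/-- A mean value inequality. -/
theorem sq_mul_le_average (hu : HarmonicZeroExt U Ω u) {s s₁ : ℝ} (hs : s < s₁)
    (hU : closedBall c (Real.exp s₁) ⊆ U) :
    u c ^ 2 * ∫ x : Esp d, wt x ≤ ∫ x, wt x * u (c + Real.exp s • x) ^ 2 := by
  have hlim : Tendsto (fun n : ℕ => ∫ x, wt x * u (c + Real.exp (s - n) • x) ^ 2) atTop
      (𝓝 (∫ x : Esp d, wt x * u c ^ 2)) := by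
    have hc : ContinuousOn (fun x => |u x|) (closedBall c (Real.exp s₁)) := (hu.cont.mono hU).abs
    obtain ⟨C, hC⟩ := (isCompact_closedBall c (Real.exp s₁)).bddAbove_image hc
    have hsn : ∀ n : ℕ, s - n ≤ s₁ := fun n => by
      have : (0 : ℝ) ≤ n := Nat.cast_nonneg n
      linarith
    refine tendsto_integral_of_dominated_convergence (fun x => wt x * C ^ 2) ?_ ?_ ?_ ?_
    · intro n
      exact (integrable_weight_mul continuous_wt (fun x hx => wt_eq_zero hx)
        ((continuousOn_comp_scale (hu.cont) (Real.exp_pos _).le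
          (Real.exp_le_exp.2 (hsn n)) hU).pow 2)).aestronglyMeasurable
    · exact integrable_weight_mul continuous_wt (fun x hx => wt_eq_zero hx) continuousOn_const
    · intro n
      refine Eventually.of_forall fun x => ?_
      by_cases hx : x ∈ closedBall (0 : Esp d) 1
      · rw [Real.norm_eq_abs, abs_mul, abs_of_nonneg (wt_nonneg x), abs_pow]
        refine mul_le_mul_of_nonneg_left (pow_le_pow_left₀ (abs_nonneg _) ?_ 2) (wt_nonneg x)
        have h1 : c + Real.exp (s - n) • x ∈ closedBall c (Real.exp s₁) :=
          closedBall_subset_preimage (U := closedBall c (Real.exp s₁)) (Real.exp_pos _).le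
            (Real.exp_le_exp.2 (hsn n)) Subset.rfl hx
        exact hC (mem_image_of_mem (fun x => |u x|) h1)
      · simp [wt_eq_zero hx]
    · refine Eventually.of_forall fun x => ?_
      have h1 : Tendsto (fun n : ℕ => s - n) atTop atBot :=
        tendsto_atBot_add_const_left _ s (tendsto_neg_atTop_atBot.comp tendsto_natCast_atTop_atTop)
      have h2 : Tendsto (fun n : ℕ => c + Real.exp (s - n) • x) atTop (𝓝 c) := by
        simpa using ((Real.tendsto_exp_atBot.comp h1).smul_const x).const_add c
      have h3 : ContinuousAt u c := hu.cont.continuousAt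
        (hu.isOpen_dom.mem_nhds (hU (mem_closedBall_self (Real.exp_pos _).le)))
      exact ((h3.tendsto.comp h2).pow 2).const_mul (wt x)
  have h := ge_of_tendsto' (hlim) (b := 0) fun n => integral_nonneg fun x =>
    mul_nonneg (wt_nonneg x) (sq_nonneg _)
  rw [mul_comm, ← integral_mul_const]
  refine le_of_tendsto' hlim fun n => ?_
  have : (0 : ℝ) ≤ n := Nat.cast_nonneg n
  exact hu.average_mono hU (show s - n < s₁ by linarith) hs (by linarith)

end HarmonicZeroExt

namespace HarmonicZeroExt

open Filter Topology

variable {d : ℕ} {U Ω : Set (Esp d)} {u : Esp d → ℝ} {c : Esp d} {s s₁ t ε : ℝ}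

theorem scale_inter_subset {R : ℝ}
    (star : ∀ z ∈ Ω, z ∈ closedBall c R → ∀ l ∈ Icc (0 : ℝ) 1, c + l • (z - c) ∈ Ω)
    (hs : Real.exp s ≤ R) (ht : t ≤ s) :
    closedBall 0 1 ∩ (fun x => c + Real.exp s • x) ⁻¹' Ω ⊆
      (fun x => c + Real.exp t • x) ⁻¹' Ω := by
  rintro x ⟨hx, hxΩ⟩
  have h1 : c + Real.exp s • x ∈ closedBall c R :=
    closedBall_subset_preimage (U := closedBall c R) (Real.exp_pos _).le hs Subset.rfl hx
  have h2 := star _ hxΩ h1 (Real.exp (t - s))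
    ⟨(Real.exp_pos _).le, Real.exp_le_one_iff.2 (by linarith)⟩
  rw [add_sub_cancel_left, smul_smul, ← Real.exp_add, sub_add_cancel] at h2
  exact h2

theorem hasDerivAt_scale (hu : HarmonicZeroExt U Ω u) {x : Esp d}
    (hx : c + Real.exp t • x ∈ Ω) :
    HasDerivAt (fun t => u (c + Real.exp t • x))
      (fderiv ℝ u (c + Real.exp t • x) (Real.exp t • x)) t :=
  (hu.hasFDerivAt hx).comp_hasDerivAt t (((Real.hasDerivAt_exp t).smul_const x).const_add c)

theorem fderiv_scale_apply (hu : HarmonicZeroExt U Ω u) {x : Esp d}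
    (hx : c + Real.exp t • x ∈ Ω) :
    fderiv ℝ (fun x => u (c + Real.exp t • x)) x x =
      fderiv ℝ u (c + Real.exp t • x) (Real.exp t • x) := by
  have hd : HasFDerivAt (fun x : Esp d => c + Real.exp t • x)
      (Real.exp t • ContinuousLinearMap.id ℝ (Esp d)) x :=
    ((hasFDerivAt_id x).const_smul (Real.exp t)).const_add c
  have h : HasFDerivAt (fun x => u (c + Real.exp t • x)) _ x := (hu.hasFDerivAt hx).comp x hd
  rw [h.fderiv]
  simp

/-- Growth of the truncated correlation between two scales. -/
theorem trunc_correlation_sub_le (hu : HarmonicZeroExt U Ω u) (hs : s < s₁)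
    (hU : closedBall c (Real.exp s₁) ⊆ U)
    (star : ∀ z ∈ Ω, z ∈ closedBall c (Real.exp s) → ∀ l ∈ Icc (0 : ℝ) 1, c + l • (z - c) ∈ Ω)
    (hts : t < s) (hε : 0 < ε) {η : ℝ} (hη : 0 < η) :
    (∫ x, wt x * trunc ε (u (c + Real.exp s • x)) * u (c + Real.exp s • x)) -
        ∫ x, wt x * trunc ε (u (c + Real.exp s • x)) * u (c + Real.exp t • x) ≤
      (η * (s - t) * (∫ x, wtDiv x * u (c + Real.exp s • x) ^ 2) +
        ((∫ x, wt x * u (c + Real.exp s • x) ^ 2) -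
          ∫ x, wt x * u (c + Real.exp t • x) ^ 2) / η) / 4 := by
  have hv : ∀ τ : ℝ, HarmonicZeroExt ((fun x => c + Real.exp τ • x) ⁻¹' U)
    ((fun x => c + Real.exp τ • x) ⁻¹' Ω) (fun x => u (c + Real.exp τ • x)) :=
    fun τ => hu.comp_smul c
  have hK : ∀ τ ≤ s₁, closedBall (0 : Esp d) 1 ⊆ (fun x => c + Real.exp τ • x) ⁻¹' U :=
    fun τ hτ => closedBall_subset_preimage (Real.exp_pos _).le (Real.exp_le_exp.2 hτ) hU
  have hincl : ∀ τ ≤ s, closedBall 0 1 ∩ (fun x => c + Real.exp s • x) ⁻¹' Ω ⊆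
      (fun x => c + Real.exp τ • x) ⁻¹' Ω := fun τ hτ => scale_inter_subset star le_rfl hτ
  set P : Set (Esp d) := closedBall 0 1 ∩ {x | ε ≤ |u (c + Real.exp s • x)|}
  have hP : IsCompact P := (hv s).isCompact_superlevel (hK s hs.le) ε
  have hPΩ : P ⊆ closedBall 0 1 ∩ (fun x => c + Real.exp s • x) ⁻¹' Ω :=
    inter_subset_inter_right _ ((hv s).superlevel_subset hε)
  have hV : ∀ x ∉ P, wt x * trunc ε (u (c + Real.exp s • x)) = 0 := by
    intro x hx
    by_cases hx1 : x ∈ closedBall (0 : Esp d) 1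
    · have : ¬ ε ≤ |u (c + Real.exp s • x)| := fun h => hx ⟨hx1, h⟩
      rw [trunc_eq_zero hε (not_le.1 this).le, mul_zero]
    · rw [wt_eq_zero hx1, zero_mul]
  have hint : ∀ {b : Esp d → ℝ},
      ContinuousOn b (closedBall 0 1 ∩ (fun x => c + Real.exp s • x) ⁻¹' Ω) →
      Integrable fun x => wt x * trunc ε (u (c + Real.exp s • x)) * b x :=
    fun hb => (hv s).integrable_trunc_mul (hK s hs.le) hε hb
  have hV1 : Integrable fun x => wt x * trunc ε (u (c + Real.exp s • x)) := by
    simpa using hint (b := fun _ => 1) continuousOn_const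
  have hFi : ∀ τ ≤ s₁, Integrable fun x =>
      wt x * trunc ε (u (c + Real.exp s • x)) * u (c + Real.exp τ • x) := fun τ hτ =>
    hint (((hv τ).cont.mono (hK τ hτ)).mono inter_subset_left)
  set F : ℝ → ℝ := fun τ =>
    ∫ x, wt x * trunc ε (u (c + Real.exp s • x)) * u (c + Real.exp τ • x)
  set f : ℝ → ℝ := fun τ => ∫ x, wt x * u (c + Real.exp τ • x) ^ 2
  have hFc : ContinuousOn F (Icc t s) := by
    obtain ⟨C, hC⟩ := (isCompact_closedBall c (Real.exp s₁)).bddAbove_image (hu.cont.mono hU).abs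
    refine continuousOn_of_dominated
      (bound := fun x => |wt x * trunc ε (u (c + Real.exp s • x))| * C)
      (fun τ hτ => (hFi τ (hτ.2.trans hs.le)).aestronglyMeasurable) ?_ (hV1.abs.mul_const C) ?_
    · refine fun τ hτ => Eventually.of_forall fun x => ?_
      by_cases hx : x ∈ P
      · rw [norm_mul, Real.norm_eq_abs, Real.norm_eq_abs]
        have h1 : c + Real.exp τ • x ∈ closedBall c (Real.exp s₁) :=
          closedBall_subset_preimage (U := closedBall c (Real.exp s₁)) (Real.exp_pos _).le
            (Real.exp_le_exp.2 (hτ.2.trans hs.le)) Subset.rfl hx.1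
        exact mul_le_mul_of_nonneg_left (hC (mem_image_of_mem (fun x => |u x|) h1)) (abs_nonneg _)
      · simp [hV x hx]
    · refine Eventually.of_forall fun x => ?_
      by_cases hx : x ∈ P
      · refine continuousOn_const.mul fun τ hτ => ContinuousAt.continuousWithinAt ?_
        exact (hu.hasDerivAt_scale (hincl τ hτ.2 (hPΩ hx))).continuousAt
      · simp only [hV x hx, zero_mul]
        exact continuousOn_const
  have hF' : ∀ τ ∈ Ioo t s, HasDerivAt F (∫ x, wt x * trunc ε (u (c + Real.exp s • x)) *
      fderiv ℝ (fun x => u (c + Real.exp τ • x)) x x) τ := by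
    intro τ hτ
    have hcont : ContinuousOn (fun p : ℝ × Esp d =>
        fderiv ℝ u (c + Real.exp p.1 • p.2) (Real.exp p.1 • p.2)) (Icc t s ×ˢ P) := by
      refine ContinuousOn.clm_apply (hu.continuousOn_fderiv.comp (by fun_prop) ?_) (by fun_prop)
      rintro ⟨σ, x⟩ ⟨hσ, hx⟩
      exact hincl σ hσ.2 (hPΩ hx)
    obtain ⟨C, hC⟩ := (isCompact_Icc.prod hP).bddAbove_image hcont.abs
    have hcong : ∀ x, wt x * trunc ε (u (c + Real.exp s • x)) *
          fderiv ℝ (fun x => u (c + Real.exp τ • x)) x x =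
        wt x * trunc ε (u (c + Real.exp s • x)) *
          fderiv ℝ u (c + Real.exp τ • x) (Real.exp τ • x) := by
      intro x
      by_cases hx : x ∈ P
      · rw [hu.fderiv_scale_apply (hincl τ hτ.2.le (hPΩ hx))]
      · simp [hV x hx]
    have hi : Integrable fun x => wt x * trunc ε (u (c + Real.exp s • x)) *
          fderiv ℝ (fun x => u (c + Real.exp τ • x)) x x :=
      hint (((hv τ).continuousOn_fderiv.mono (hincl τ hτ.2.le)).clm_apply continuousOn_id)
    simp_rw [hcong] at hi ⊢
    refine (hasDerivAt_integral_of_dominated_loc_of_deriv_le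
      (bound := fun x => |wt x * trunc ε (u (c + Real.exp s • x))| * C) (s := Ioo t s)
      (F' := fun τ x => wt x * trunc ε (u (c + Real.exp s • x)) *
        fderiv ℝ u (c + Real.exp τ • x) (Real.exp τ • x))
      (Ioo_mem_nhds hτ.1 hτ.2) ?_ (hFi τ (hτ.2.trans hs).le) hi.aestronglyMeasurable ?_
      (hV1.abs.mul_const C) ?_).2
    · filter_upwards [Iio_mem_nhds (hτ.2.trans hs)] with σ hσ
      exact (hFi σ (le_of_lt hσ)).aestronglyMeasurable
    · refine Eventually.of_forall fun x σ hσ => ?_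
      by_cases hx : x ∈ P
      · rw [norm_mul, Real.norm_eq_abs, Real.norm_eq_abs]
        refine mul_le_mul_of_nonneg_left ?_ (abs_nonneg _)
        exact hC (mem_image_of_mem (fun p : ℝ × Esp d =>
          |fderiv ℝ u (c + Real.exp p.1 • p.2) (Real.exp p.1 • p.2)|)
          (show (σ, x) ∈ Icc t s ×ˢ P from ⟨Ioo_subset_Icc_self hσ, hx⟩))
      · simp [hV x hx]
    · refine Eventually.of_forall fun x σ hσ => ?_
      by_cases hx : x ∈ P
      · exact (hu.hasDerivAt_scale (hincl σ hσ.2.le (hPΩ hx))).const_mul _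
      · simp only [hV x hx, zero_mul]
        exact hasDerivAt_const _ _
  set Q := ∫ x, wtDiv x * u (c + Real.exp s • x) ^ 2
  have hG' : ∀ τ ∈ Ioo t s, HasDerivAt (fun τ => F τ - (η * Q * τ + f τ / η) / 4) _ τ :=
    fun τ hτ => (hF' τ hτ).fun_sub
      ((((hasDerivAt_id' τ).const_mul (η * Q)).fun_add
        ((hu.hasDerivAt_average (hτ.2.trans hs) hU).div_const η)).div_const 4)
  have hanti : AntitoneOn (fun τ => F τ - (η * Q * τ + f τ / η) / 4) (Icc t s) := by
    refine antitoneOn_of_deriv_nonpos (convex_Icc t s) ?_ ?_ ?_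
    · refine hFc.sub (((continuousOn_const.mul continuousOn_id).add
        (ContinuousOn.div_const ?_ η)).div_const 4)
      exact fun τ hτ =>
        (hu.hasDerivAt_average (hτ.2.trans_lt hs) hU).continuousAt.continuousWithinAt
    · rw [interior_Icc]
      exact fun τ hτ => (hG' τ hτ).differentiableAt.differentiableWithinAt
    · rw [interior_Icc]
      intro τ hτ
      rw [(hG' τ hτ).deriv]
      have := (hv s).integral_trunc_fderiv_le (hK s hs.le) (hv τ) (hK τ (hτ.2.trans hs).le)
        (hincl τ hτ.2.le) hε hη
      simp only [mul_one]
      linarith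
  have := hanti (left_mem_Icc.2 hts.le) (right_mem_Icc.2 hts.le) hts.le
  simp only at this
  have e : (η * (s - t) * Q + (f s - f t) / η) / 4 =
    (η * Q * s + f s / η) / 4 - (η * Q * t + f t / η) / 4 := by ring
  rw [e]
  linarith

theorem abs_trunc_correlation_sub_le (hu : HarmonicZeroExt U Ω u) (hs : s ≤ s₁) (ht : t ≤ s₁)
    (hU : closedBall c (Real.exp s₁) ⊆ U) (hε : 0 < ε) :
    |(∫ x, wt x * trunc ε (u (c + Real.exp s • x)) * u (c + Real.exp t • x)) -
        ∫ x, wt x * (u (c + Real.exp s • x) * u (c + Real.exp t • x))| ≤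
      ε * (2 * ∫ x, wt x * |u (c + Real.exp t • x)|) := by
  have hcs := continuousOn_comp_scale hu.cont (Real.exp_pos s).le (Real.exp_le_exp.2 hs) hU
  have hct := continuousOn_comp_scale hu.cont (Real.exp_pos t).le (Real.exp_le_exp.2 ht) hU
  have h0 : ∀ x ∉ closedBall (0 : Esp d) 1, wt x = 0 := fun x hx => wt_eq_zero hx
  have i1 : Integrable fun x =>
      wt x * (trunc ε (u (c + Real.exp s • x)) * u (c + Real.exp t • x)) :=
    integrable_weight_mul continuous_wt h0
      (((continuous_trunc (ε := ε)).comp_continuousOn hcs).mul hct)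
  have i2 : Integrable fun x => wt x * (u (c + Real.exp s • x) * u (c + Real.exp t • x)) :=
    integrable_weight_mul continuous_wt h0 (hcs.mul hct)
  have i3 := integrable_weight_mul continuous_wt h0 hct.abs
  simp_rw [mul_assoc]
  rw [← integral_sub i1 i2, ← integral_const_mul, ← integral_const_mul]
  refine abs_integral_le_integral_abs.trans (integral_mono (i1.sub i2).abs
    ((i3.const_mul 2).const_mul ε) fun x => ?_)
  have h4 : ∀ a b c : ℝ, wt x * (a * b) - wt x * (c * b) = wt x * ((a - c) * b) := by
    intros; ring
  simp only
  rw [h4, abs_mul, abs_mul, abs_of_nonneg (wt_nonneg x)]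
  calc _ ≤ wt x * (2 * ε * |u (c + Real.exp t • x)|) := by
        have := wt_nonneg x
        gcongr
        exact abs_trunc_sub_le hε _
    _ = _ := by ring

theorem le_of_forall_le_add_mul {a b C : ℝ} (h : ∀ ε > 0, a ≤ b + ε * C) : a ≤ b := by
  refine le_of_tendsto_of_tendsto (f := fun _ : ℝ => a) (g := fun ε : ℝ => b + ε * C)
    (b := 𝓝[>] 0) tendsto_const_nhds ?_ (eventually_mem_nhdsWithin.mono fun ε hε => h ε hε)
  have : Tendsto (fun ε : ℝ => b + ε * C) (𝓝 0) (𝓝 (b + 0 * C)) :=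
    Continuous.tendsto (by fun_prop) 0
  rw [zero_mul, add_zero] at this
  exact this.mono_left nhdsWithin_le_nhds

theorem average_le (hu : HarmonicZeroExt U Ω u) (hs : s < s₁)
    (hU : closedBall c (Real.exp s₁) ⊆ U)
    (star : ∀ z ∈ Ω, z ∈ closedBall c (Real.exp s) → ∀ l ∈ Icc (0 : ℝ) 1, c + l • (z - c) ∈ Ω)
    (hts : t < s) {κ η : ℝ} (hκ : 0 < κ) (hη : 0 < η) :
    ∫ x, wt x * u (c + Real.exp s • x) ^ 2 ≤
      (κ * (∫ x, wt x * u (c + Real.exp s • x) ^ 2) +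
        (∫ x, wt x * u (c + Real.exp t • x) ^ 2) / κ) / 2 +
      (η * (s - t) * (∫ x, wtDiv x * u (c + Real.exp s • x) ^ 2) +
        ((∫ x, wt x * u (c + Real.exp s • x) ^ 2) -
          ∫ x, wt x * u (c + Real.exp t • x) ^ 2) / η) / 4 := by
  have ht := hts.trans hs
  have hcs := continuousOn_comp_scale hu.cont (Real.exp_pos s).le (Real.exp_le_exp.2 hs.le) hU
  have hct := continuousOn_comp_scale hu.cont (Real.exp_pos t).le (Real.exp_le_exp.2 ht.le) hU
  have h0 : ∀ x ∉ closedBall (0 : Esp d) 1, wt x = 0 := fun x hx => wt_eq_zero hx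
  have i1 : Integrable fun x => wt x * u (c + Real.exp s • x) ^ 2 :=
    integrable_weight_mul continuous_wt h0 (hcs.pow 2)
  have i2 : Integrable fun x => wt x * u (c + Real.exp t • x) ^ 2 :=
    integrable_weight_mul continuous_wt h0 (hct.pow 2)
  have i3 : Integrable fun x => wt x * (u (c + Real.exp s • x) * u (c + Real.exp t • x)) :=
    integrable_weight_mul continuous_wt h0 (hcs.mul hct)
  have hAMGM : ∫ x, wt x * (u (c + Real.exp s • x) * u (c + Real.exp t • x)) ≤
      (κ * (∫ x, wt x * u (c + Real.exp s • x) ^ 2) +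
        (∫ x, wt x * u (c + Real.exp t • x) ^ 2) / κ) / 2 := by
    rw [← integral_const_mul, ← integral_div, ← integral_add (i1.const_mul κ) (i2.div_const κ),
      ← integral_div]
    refine integral_mono i3 (((i1.const_mul κ).add (i2.div_const κ)).div_const 2) fun x => ?_
    simp only
    set p := u (c + Real.exp s • x)
    set q := u (c + Real.exp t • x)
    have h1 : (κ * (wt x * p ^ 2) + wt x * q ^ 2 / κ) / 2 - wt x * (p * q) =
        wt x * (κ * p - q) ^ 2 / (2 * κ) := by field_simp; ring
    have h2 : 0 ≤ wt x * (κ * p - q) ^ 2 / (2 * κ) :=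
      div_nonneg (mul_nonneg (wt_nonneg x) (sq_nonneg _)) (by positivity)
    linarith
  have key : (∫ x, wt x * u (c + Real.exp s • x) ^ 2) -
      (∫ x, wt x * (u (c + Real.exp s • x) * u (c + Real.exp t • x))) ≤
      (η * (s - t) * (∫ x, wtDiv x * u (c + Real.exp s • x) ^ 2) +
        ((∫ x, wt x * u (c + Real.exp s • x) ^ 2) -
          ∫ x, wt x * u (c + Real.exp t • x) ^ 2) / η) / 4 := by
    refine le_of_forall_le_add_mul (C := (2 * ∫ x, wt x * |u (c + Real.exp s • x)|) +
      2 * ∫ x, wt x * |u (c + Real.exp t • x)|) fun ε hε => ?_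
    have h1 := hu.trunc_correlation_sub_le hs hU star hts hε hη
    have h2 := abs_le.1 (hu.abs_trunc_correlation_sub_le hs.le hs.le hU hε)
    have h3 := abs_le.1 (hu.abs_trunc_correlation_sub_le hs.le ht.le hU hε)
    simp_rw [← pow_two] at h2
    rw [mul_add]
    linarith [h2.1, h3.2]
  linarith

/-- Three balls inequality for weighted averages. -/
theorem average_pow_three_le (hu : HarmonicZeroExt U Ω u) {a b : ℝ} (hab : a < b) (hb : b < s₁)
    (hU : closedBall c (Real.exp s₁) ⊆ U)
    (star : ∀ z ∈ Ω, z ∈ closedBall c (Real.exp b) → ∀ l ∈ Icc (0 : ℝ) 1, c + l • (z - c) ∈ Ω) :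
    (∫ x, wt x * u (c + Real.exp ((a + 2 * b) / 3) • x) ^ 2) ^ 3 ≤
      (∫ x, wt x * u (c + Real.exp a • x) ^ 2) *
        (∫ x, wt x * u (c + Real.exp b • x) ^ 2) ^ 2 := by
  refine log_convex_of_nonneg (f := fun s => ∫ x, wt x * u (c + Real.exp s • x) ^ 2)
    (f' := fun s => ∫ x, wtDiv x * u (c + Real.exp s • x) ^ 2) hab ?_ ?_ ?_ ?_ ?_
  · exact fun s hs =>
      (hu.hasDerivAt_average (hs.2.trans_lt hb) hU).continuousAt.continuousWithinAt
  · exact fun s hs => hu.hasDerivAt_average (hs.2.trans hb) hU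
  · exact fun s hs => hu.average_deriv_nonneg (hs.2.trans hb).le hU
  · exact fun s _ => integral_nonneg fun x => mul_nonneg (wt_nonneg x) (sq_nonneg _)
  · intro s hs t ht κ hκ η hη
    exact hu.average_le (hs.2.trans hb) hU (fun z hz hzb => star z hz
      (closedBall_subset_closedBall (Real.exp_le_exp.2 hs.2.le) hzb)) ht.2 hκ hη

end HarmonicZeroExt

section WeightComparison

open Module

variable {d : ℕ}

/-- The profile of the weight `wt`, as a function of the squared norm. -/
def profile (T : ℝ) : ℝ := (1 - T) ^ 2 * (1 + 2 * T)

theorem profile_anti {S T : ℝ} (hS : 0 ≤ S) (hST : S ≤ T) (hT : T ≤ 1) :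
    profile T ≤ profile S := by
  have h : profile S - profile T =
      (T - S) * (3 * S * (1 - S) + 3 * T * (1 - T) + (T - S) ^ 2) := by unfold profile; ring
  have : 0 ≤ (T - S) * (3 * S * (1 - S) + 3 * T * (1 - T) + (T - S) ^ 2) := by
    have h1 : 0 ≤ S * (1 - S) := mul_nonneg hS (by linarith)
    have h2 : 0 ≤ T * (1 - T) := mul_nonneg (by linarith) (by linarith)
    exact mul_nonneg (by linarith) (by nlinarith [sq_nonneg (T - S)])
  linarith

theorem wt_eq_profile {x : Esp d} (hx : ‖x‖ ≤ 1) : wt x = profile (‖x‖ ^ 2) := by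
  have : 0 ≤ 1 - ‖x‖ ^ 2 := by nlinarith [norm_nonneg x]
  rw [wt, profile, max_eq_left this]

theorem wt_eq_zero_of_one_le {x : Esp d} (hx : 1 ≤ ‖x‖) : wt x = 0 := by
  have : 1 - ‖x‖ ^ 2 ≤ 0 := by nlinarith
  simp [wt, max_eq_right this]

theorem profile_le_profile {t : ℝ} (h0 : 0 ≤ t) (h1 : t ≤ 3 / 4) :
    profile ((4 / 3 * t) ^ 2) ≤ 27 / 10 * profile ((2 / 5 * (151 / 100 + t)) ^ 2) := by
  have piece : ∀ α β : ℝ, 0 ≤ α → β ≤ 3 / 4 →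
      profile ((4 / 3 * α) ^ 2) ≤ 27 / 10 * profile ((2 / 5 * (151 / 100 + β)) ^ 2) →
      α ≤ t → t ≤ β →
      profile ((4 / 3 * t) ^ 2) ≤ 27 / 10 * profile ((2 / 5 * (151 / 100 + t)) ^ 2) := by
    intro α β hα hβ h ht1 ht2
    have e1 : profile ((4 / 3 * t) ^ 2) ≤ profile ((4 / 3 * α) ^ 2) :=
      profile_anti (by positivity) (by gcongr) (by nlinarith)
    have e2 : profile ((2 / 5 * (151 / 100 + β)) ^ 2) ≤
        profile ((2 / 5 * (151 / 100 + t)) ^ 2) :=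
      profile_anti (by positivity) (by gcongr) (by nlinarith)
    linarith
  rcases le_total t (3 / 10) with h | h
  · exact piece 0 (3 / 10) (by norm_num) (by norm_num) (by norm_num [profile]) h0 h
  rcases le_total t (2 / 5) with h' | h'
  · exact piece (3 / 10) (2 / 5) (by norm_num) (by norm_num) (by norm_num [profile]) h h'
  rcases le_total t (9 / 20) with h | h
  · exact piece (2 / 5) (9 / 20) (by norm_num) (by norm_num) (by norm_num [profile]) h' h
  rcases le_total t (1 / 2) with h' | h'
  · exact piece (9 / 20) (1 / 2) (by norm_num) (by norm_num) (by norm_num [profile]) h h'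
  rcases le_total t (11 / 20) with h | h
  · exact piece (1 / 2) (11 / 20) (by norm_num) (by norm_num) (by norm_num [profile]) h' h
  rcases le_total t (3 / 5) with h' | h'
  · exact piece (11 / 20) (3 / 5) (by norm_num) (by norm_num) (by norm_num [profile]) h h'
  rcases le_total t (13 / 20) with h | h
  · exact piece (3 / 5) (13 / 20) (by norm_num) (by norm_num) (by norm_num [profile]) h' h
  · exact piece (13 / 20) (3 / 4) (by norm_num) (by norm_num) (by norm_num [profile]) h h1

theorem wt_le_wt {ρ : ℝ} (hρ : 0 < ρ) {y p z : Esp d} (hyp : dist y p ≤ 151 / 100 * ρ) :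
    wt ((3 / 4 * ρ)⁻¹ • (z - y)) ≤ 27 / 10 * wt ((5 / 2 * ρ)⁻¹ • (z - p)) := by
  set t := ‖z - y‖ / ρ
  have ht0 : 0 ≤ t := by positivity
  have hzy : ‖z - y‖ = t * ρ := by simp [t, hρ.ne']
  have h1 : ‖(3 / 4 * ρ)⁻¹ • (z - y)‖ = 4 / 3 * t := by
    rw [norm_smul, Real.norm_eq_abs, abs_of_pos (by positivity), hzy]; field_simp
  rcases le_total t (3 / 4) with ht | ht
  · have hzp : ‖z - p‖ ≤ (151 / 100 + t) * ρ := by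
      have := norm_sub_le_norm_sub_add_norm_sub z y p
      rw [← dist_eq_norm y p] at this
      linarith
    have h2 : ‖(5 / 2 * ρ)⁻¹ • (z - p)‖ ≤ 2 / 5 * (151 / 100 + t) := by
      rw [norm_smul, Real.norm_eq_abs, abs_of_pos (by positivity), inv_mul_le_iff₀ (by positivity)]
      linarith
    rw [wt_eq_profile (by rw [h1]; linarith), wt_eq_profile (by linarith), h1]
    refine (profile_le_profile ht0 ht).trans (mul_le_mul_of_nonneg_left ?_ (by norm_num))
    exact profile_anti (by positivity) (by gcongr) (by nlinarith)
  · rw [wt_eq_zero_of_one_le (by rw [h1]; linarith)]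
    exact mul_nonneg (by norm_num) (wt_nonneg _)

theorem integral_wt_scale (w : Esp d → ℝ) (c : Esp d) {r : ℝ} (hr : 0 < r) :
    ∫ x, wt x * w (c + r • x) = (r ^ d)⁻¹ * ∫ z, wt (r⁻¹ • (z - c)) * w z := by
  have h := Measure.integral_comp_smul (volume : Measure (Esp d))
    (fun z => wt (r⁻¹ • z) * w (c + z)) r
  simp only [smul_smul, inv_mul_cancel₀ hr.ne', one_smul] at h
  rw [h, finrank_euclideanSpace_fin, abs_of_pos (by positivity), smul_eq_mul]
  congr 1
  rw [← integral_add_left_eq_self (fun z => wt (r⁻¹ • (z - c)) * w z) c]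
  simp only [add_sub_cancel_left]

end WeightComparison

namespace HarmonicZeroExt

variable {d : ℕ} {U Ω : Set (Esp d)} {u : Esp d → ℝ}

/-- Comparison of a weighted average with a larger, off-centre one. -/
theorem average_le_average (hu : HarmonicZeroExt U Ω u) {ρ : ℝ} (hρ : 0 < ρ) {y p : Esp d}
    (hU : closedBall p (8 * ρ) ⊆ U) (hyp : dist y p ≤ 151 / 100 * ρ) :
    ∫ x, wt x * u (y + (3 / 4 * ρ) • x) ^ 2 ≤
      27 / 10 * (10 / 3) ^ d * ∫ x, wt x * u (p + (5 / 2 * ρ) • x) ^ 2 := by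
  have hint : ∀ {q : Esp d} {r : ℝ}, 0 < r → closedBall q r ⊆ U →
      Integrable fun z => wt (r⁻¹ • (z - q)) * u z ^ 2 := by
    intro q r hr hq
    refine integrable_of_eq_zero_off_compact (isCompact_closedBall q r)
      ((Continuous.continuousOn (by fun_prop)).mul ((hu.cont.mono hq).pow 2)) fun z hz => ?_
    rw [wt_eq_zero_of_one_le, zero_mul]
    rw [mem_closedBall, not_le, dist_eq_norm] at hz
    rw [norm_smul, Real.norm_eq_abs, abs_of_pos (by positivity), inv_mul_eq_div,
      one_le_div hr]
    exact hz.le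
  have h1 : closedBall y (3 / 4 * ρ) ⊆ U :=
    (closedBall_subset_closedBall' (by linarith)).trans hU
  have h2 : closedBall p (5 / 2 * ρ) ⊆ U :=
    (closedBall_subset_closedBall (by linarith)).trans hU
  rw [integral_wt_scale (fun z => u z ^ 2) y (by positivity),
    integral_wt_scale (fun z => u z ^ 2) p (by positivity)]
  calc _ ≤ ((3 / 4 * ρ) ^ d)⁻¹ *
        ∫ z, 27 / 10 * (wt ((5 / 2 * ρ)⁻¹ • (z - p)) * u z ^ 2) := by
        refine mul_le_mul_of_nonneg_left ?_ (by positivity)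
        refine integral_mono (hint (by positivity) h1)
          ((hint (by positivity) h2).const_mul (27 / 10)) fun z => ?_
        simp only
        rw [← mul_assoc]
        exact mul_le_mul_of_nonneg_right (wt_le_wt hρ hyp) (sq_nonneg _)
    _ = _ := by
        rw [integral_const_mul]
        have : ((3 / 4 * ρ) ^ d)⁻¹ = (10 / 3) ^ d * ((5 / 2 * ρ) ^ d)⁻¹ := by
          rw [← inv_pow, ← inv_pow, ← mul_pow]
          congr 1
          field_simp
          norm_num
        rw [this]; ring

theorem average_le_sq_mul (hu : HarmonicZeroExt U Ω u) {p : Esp d} {r M : ℝ} (hr : 0 < r)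
    (hU : closedBall p r ⊆ U) (hM : ∀ z ∈ ball p r, |u z| ≤ M) :
    ∫ x, wt x * u (p + r • x) ^ 2 ≤ M ^ 2 * ∫ x : Esp d, wt x := by
  have hc := continuousOn_comp_scale hu.cont hr.le le_rfl hU
  have h0 : ∀ x ∉ closedBall (0 : Esp d) 1, wt x = 0 := fun x hx => wt_eq_zero hx
  rw [mul_comm, ← integral_mul_const]
  refine integral_mono (integrable_weight_mul continuous_wt h0 (hc.pow 2))
    (integrable_weight_mul continuous_wt h0 continuousOn_const) fun x => ?_
  rcases le_or_gt 1 ‖x‖ with hx | hx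
  · simp [wt_eq_zero_of_one_le hx]
  · refine mul_le_mul_of_nonneg_left ?_ (wt_nonneg x)
    rw [← sq_abs (u _)]
    refine pow_le_pow_left₀ (abs_nonneg _) (hM _ ?_) 2
    rw [mem_ball, dist_self_add_left, norm_smul, Real.norm_eq_abs, abs_of_pos hr]
    nlinarith

/-- The three balls inequality for a domain that is almost star-shaped with respect to the
centre of the balls. -/
theorem abs_pow_three_le (hu : HarmonicZeroExt U Ω u) (hd : 1 ≤ d) {ρ : ℝ} (hρ : 0 < ρ)
    {y₀ p : Esp d} (hp : dist p y₀ ≤ ρ / 100) (hU : closedBall p (8 * ρ) ⊆ U)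
    (star : ∀ z ∈ Ω, z ∈ ball p (4 * ρ) → ∀ l ∈ Icc (0 : ℝ) 1, p + l • (z - p) ∈ Ω)
    {M₁ M₄ : ℝ} (h₁ : ∀ z ∈ ball y₀ ρ, |u z| ≤ M₁) (h₄ : ∀ z ∈ ball y₀ (4 * ρ), |u z| ≤ M₄)
    {y : Esp d} (hy : dist y y₀ < 3 / 2 * ρ) :
    |u y| ^ 3 ≤ 27 ^ d * (M₁ * M₄ ^ 2) := by
  have hM₁ : 0 ≤ M₁ := (abs_nonneg _).trans (h₁ y₀ (mem_ball_self hρ))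
  have hM₄ : 0 ≤ M₄ := (abs_nonneg _).trans (h₄ y₀ (mem_ball_self (by positivity)))
  have hsub : ∀ r ≤ 8 * ρ, closedBall p r ⊆ U := fun r hr =>
    (closedBall_subset_closedBall hr).trans hU
  have hUexp : closedBall p (Real.exp (Real.log (8 * ρ))) ⊆ U := by
    rwa [Real.exp_log (by positivity)]
  set S := ∫ x : Esp d, wt x
  have hS : 0 < S := integral_wt_pos
  set A : ℝ → ℝ := fun s => ∫ x, wt x * u (p + Real.exp s • x) ^ 2
  have hA0 : ∀ s, 0 ≤ A s := fun s => integral_nonneg fun x =>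
    mul_nonneg (wt_nonneg x) (sq_nonneg _)
  set a := Real.log (99 / 100 * ρ)
  set b := Real.log (399 / 100 * ρ)
  have ea : Real.exp a = 99 / 100 * ρ := Real.exp_log (by positivity)
  have eb : Real.exp b = 399 / 100 * ρ := Real.exp_log (by positivity)
  have hab : a < b := Real.log_lt_log (by positivity) (by linarith)
  have hb : b < Real.log (8 * ρ) := Real.log_lt_log (by positivity) (by linarith)
  have hAa : A a ≤ M₁ ^ 2 * S := by
    simp only [A, ea]
    refine hu.average_le_sq_mul (by positivity) (hsub _ (by linarith)) fun z hz => h₁ z ?_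
    exact ball_subset_ball' (by linarith) hz
  have hAb : A b ≤ M₄ ^ 2 * S := by
    simp only [A, eb]
    refine hu.average_le_sq_mul (by positivity) (hsub _ (by linarith)) fun z hz => h₄ z ?_
    exact ball_subset_ball' (by linarith) hz
  have hmid : A (Real.log (5 / 2 * ρ)) ≤ A ((a + 2 * b) / 3) := by
    refine hu.average_mono hUexp (Real.log_lt_log (by positivity) (by linarith))
      (show (a + 2 * b) / 3 < _ by linarith) ?_
    have h1 : Real.log ((5 / 2 * ρ) ^ 3) ≤ Real.log (99 / 100 * ρ * (399 / 100 * ρ) ^ 2) := by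
      refine Real.log_le_log (by positivity) ?_
      have : 0 < ρ ^ 3 := by positivity
      nlinarith
    rw [Real.log_mul (by positivity) (by positivity), Real.log_pow, Real.log_pow] at h1
    push_cast at h1
    linarith
  have hA3 : A (Real.log (5 / 2 * ρ)) ^ 3 ≤ (M₁ * M₄ ^ 2) ^ 2 * S ^ 3 := by
    have h3 := hu.average_pow_three_le hab hb hUexp fun z hz hzb => star z hz (by
      rw [eb] at hzb
      exact closedBall_subset_ball (by linarith) hzb)
    calc A (Real.log (5 / 2 * ρ)) ^ 3 ≤ A ((a + 2 * b) / 3) ^ 3 :=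
          pow_le_pow_left₀ (hA0 _) hmid 3
      _ ≤ A a * A b ^ 2 := h3
      _ ≤ (M₁ ^ 2 * S) * (M₄ ^ 2 * S) ^ 2 := by
          gcongr
          · exact hA0 b
      _ = _ := by ring
  have hyp : dist y p ≤ 151 / 100 * ρ := by
    have := dist_triangle y y₀ p
    rw [dist_comm y₀ p] at this
    linarith
  have hyU : closedBall y (Real.exp (Real.log ρ)) ⊆ U := by
    rw [Real.exp_log hρ]
    exact (closedBall_subset_closedBall' (by linarith)).trans hU
  have hmean := hu.sq_mul_le_average
    (Real.log_lt_log (by positivity) (show 3 / 4 * ρ < ρ by linarith)) hyU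
  rw [Real.exp_log (by positivity)] at hmean
  have hcomp := hu.average_le_average hρ hU hyp
  have h52 : A (Real.log (5 / 2 * ρ)) = ∫ x, wt x * u (p + (5 / 2 * ρ) • x) ^ 2 := by
    simp only [A]; rw [Real.exp_log (by positivity)]
  rw [← h52] at hcomp
  have hconst : (27 / 10 : ℝ) * (10 / 3) ^ d ≤ 9 ^ d := by
    obtain ⟨k, rfl⟩ := Nat.exists_eq_add_of_le hd
    rw [pow_add, pow_add]
    have : (10 / 3 : ℝ) ^ k ≤ 9 ^ k := pow_le_pow_left₀ (by norm_num) (by norm_num) k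
    linarith
  have hfin : u y ^ 2 * S ≤ 9 ^ d * A (Real.log (5 / 2 * ρ)) :=
    (hmean.trans hcomp).trans (mul_le_mul_of_nonneg_right hconst (hA0 _))
  have h6 : (|u y| ^ 3) ^ 2 * S ^ 3 ≤ (27 ^ d * (M₁ * M₄ ^ 2)) ^ 2 * S ^ 3 := by
    calc (|u y| ^ 3) ^ 2 * S ^ 3 = (u y ^ 2 * S) ^ 3 := by rw [← sq_abs (u y)]; ring
      _ ≤ (9 ^ d * A (Real.log (5 / 2 * ρ))) ^ 3 :=
          pow_le_pow_left₀ (by positivity) hfin 3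
      _ = (9 ^ d) ^ 3 * A (Real.log (5 / 2 * ρ)) ^ 3 := by ring
      _ ≤ (9 ^ d) ^ 3 * ((M₁ * M₄ ^ 2) ^ 2 * S ^ 3) := by gcongr
      _ = _ := by
          rw [show ((9 : ℝ) ^ d) ^ 3 = (27 ^ d) ^ 2 by
            rw [← pow_mul, ← pow_mul, mul_comm d, mul_comm d, pow_mul, pow_mul]; norm_num]
          ring
  exact le_of_sq_le_sq (le_of_mul_le_mul_right h6 (by positivity)) (by positivity)

end HarmonicZeroExt

section Supremum

variable {α : Type*}

theorem abs_le_iSup_mem {A : Set α} {g : α → ℝ} {C : ℝ} (hC : ∀ y ∈ A, |g y| ≤ C) {y : α}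
    (hy : y ∈ A) : |g y| ≤ ⨆ z ∈ A, |g z| := by
  have hb : BddAbove (range fun z => ⨆ _ : z ∈ A, |g z|) := by
    refine ⟨C, ?_⟩
    rintro _ ⟨z, rfl⟩
    have hC0 : 0 ≤ C := (abs_nonneg _).trans (hC y hy)
    exact Real.iSup_le (fun hz => hC z hz) hC0
  refine le_trans ?_ (le_ciSup hb y)
  simp [hy]

theorem iSup_mem_abs_nonneg (A : Set α) (g : α → ℝ) : 0 ≤ ⨆ z ∈ A, |g z| :=
  Real.iSup_nonneg fun _ => Real.iSup_nonneg fun _ => abs_nonneg _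

theorem le_of_pow_three_le {a M₁ M₄ : ℝ} (d : ℕ) (h₁ : 0 ≤ M₁) (h₄ : 0 ≤ M₄)
    (h : a ^ 3 ≤ 27 ^ d * (M₁ * M₄ ^ 2)) :
    a ≤ 3 ^ d * M₁ ^ ((1 : ℝ) / 3) * M₄ ^ ((2 : ℝ) / 3) := by
  refine le_of_pow_le_pow_left₀ three_ne_zero (by positivity) (h.trans_eq ?_)
  rw [mul_pow, mul_pow, ← Real.rpow_mul_natCast h₁, ← Real.rpow_mul_natCast h₄, ← pow_mul,
    mul_comm d 3, pow_mul]
  norm_num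
  ring

end Supremum

section Graph

variable {m : ℕ}

theorem front_add (y z : Euc m) : front (y + z) = front y + front z := by
  ext i; simp [front]

theorem front_sub (y z : Euc m) : front (y - z) = front y - front z := by
  ext i; simp [front]

theorem front_smul (c : ℝ) (y : Euc m) : front (c • y) = c • front y := by
  ext i; simp [front]

theorem front_eLast : front (eLast m) = 0 := by
  ext i; simp [front, eLast]

theorem lastC_eLast : lastC (eLast m) = 1 := by
  simp [lastC, eLast]

theorem norm_eLast : ‖eLast m‖ = 1 := by
  simp [eLast]

theorem norm_front_le (y : Euc m) : ‖front y‖ ≤ ‖y‖ := by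
  rw [EuclideanSpace.norm_eq, EuclideanSpace.norm_eq]
  refine Real.sqrt_le_sqrt ?_
  rw [Fin.sum_univ_castSucc]
  have : ∀ i, front y i = y i.castSucc := fun i => by simp [front]
  simp only [this]
  nlinarith [sq_nonneg ‖y (Fin.last m)‖]

theorem continuous_front : Continuous (front : Euc m → _) := by
  exact (PiLp.continuous_toLp 2 _).comp (by fun_prop)

theorem continuous_lastC : Continuous (lastC : Euc m → ℝ) := by
  unfold lastC
  fun_prop

/-- A Lipschitz function fails to be convex by a controlled amount. -/
theorem LipschitzOnWith.apply_combo_le {E : Type*} [NormedAddCommGroup E] [NormedSpace ℝ E]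
    {f : E → ℝ} {s : Set E} {τ : ℝ≥0} (hf : LipschitzOnWith τ f s) (hs : Convex ℝ s)
    {a b : E} (ha : a ∈ s) (hb : b ∈ s) {l : ℝ} (hl : l ∈ Icc (0 : ℝ) 1) :
    f (a + l • (b - a)) ≤ (1 - l) * f a + l * f b + 2 * (l * (1 - l)) * (τ * ‖b - a‖) := by
  have hc : a + l • (b - a) ∈ s := hs.add_smul_sub_mem ha hb hl
  have h1 := hf.dist_le_mul _ hc _ ha
  have h2 := hf.dist_le_mul _ hc _ hb
  have e1 : dist (a + l • (b - a)) a = l * ‖b - a‖ := by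
    rw [dist_eq_norm, add_sub_cancel_left, norm_smul, Real.norm_eq_abs, abs_of_nonneg hl.1]
  have e2 : dist (a + l • (b - a)) b = (1 - l) * ‖b - a‖ := by
    rw [dist_eq_norm, show a + l • (b - a) - b = (-(1 - l)) • (b - a) by module, norm_smul,
      Real.norm_eq_abs, abs_neg, abs_of_nonneg (by linarith [hl.2])]
  rw [e1] at h1
  rw [e2] at h2
  have h1' := (le_abs_self _).trans h1
  have h2' := (le_abs_self _).trans h2
  nlinarith [hl.1, hl.2, mul_le_mul_of_nonneg_left h1' (sub_nonneg.2 hl.2),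
    mul_le_mul_of_nonneg_left h2' hl.1]

theorem IsometryEquiv.map_add_smul_sub {E F : Type*} [NormedAddCommGroup E] [NormedSpace ℝ E]
    [NormedAddCommGroup F] [NormedSpace ℝ F] (T : E ≃ᵢ F) (a b : E) (l : ℝ) :
    T (a + l • (b - a)) = T a + l • (T b - T a) := by
  have := T.toRealAffineIsometryEquiv.toAffineEquiv.toAffineMap.apply_lineMap a b l
  simpa [AffineMap.lineMap_apply, add_comm] using this

/-- A point slightly above `y₀` from which the region above a Lipschitz graph looks
star-shaped. -/
theorem LipGraph.exists_center {Ω : Set (Euc m)} {τ : ℝ≥0} {x : Euc m} {R : ℝ}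
    (hG : LipGraph Ω τ x R) (hτ : (τ : ℝ) < 1 / 800) {y₀ : Euc m} {ρ : ℝ} (hρ : 0 < ρ)
    (hy₀ : y₀ ∈ closure Ω) (hB : ball y₀ (16 * ρ) ⊆ ball x R) :
    ∃ p, dist p y₀ ≤ ρ / 100 ∧
      ∀ z ∈ Ω, z ∈ ball p (4 * ρ) → ∀ l ∈ Icc (0 : ℝ) 1, p + l • (z - p) ∈ Ω := by
  obtain ⟨T, f, hT0, hf, -, hΩ⟩ := hG
  have mem_iff : ∀ w, w ∈ ball (0 : Euc m) R → (T w ∈ Ω ↔ f (front w) < lastC w) := by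
    intro w hw
    have hTw : T w ∈ ball x R := by
      rw [mem_ball, ← hT0, T.dist_eq]; exact hw
    constructor
    · intro h
      have : T w ∈ T '' {y : Euc m | y ∈ ball (0 : Euc m) R ∧ f (front y) < lastC y} :=
        hΩ ▸ ⟨h, hTw⟩
      exact ((T.injective.mem_set_image).1 this).2
    · intro h
      have : T w ∈ Ω ∩ ball x R := hΩ ▸ mem_image_of_mem T ⟨hw, h⟩
      exact this.1
  have hpre : ∀ w, T w ∈ ball y₀ (16 * ρ) → w ∈ ball (0 : Euc m) R := by
    intro w hw
    have := hB hw
    rwa [mem_ball, ← hT0, T.dist_eq] at this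
  have hfront : ∀ w : Euc m, w ∈ ball (0 : Euc m) R → front w ∈ ball (0 : _) R := by
    intro w hw
    rw [mem_ball_zero_iff] at hw ⊢
    exact (norm_front_le w).trans_lt hw
  obtain ⟨Y, rfl⟩ := T.surjective y₀
  have hY : Y ∈ ball (0 : Euc m) R := hpre Y (mem_ball_self (by positivity))
  have hYf : f (front Y) ≤ lastC Y := by
    have hcl : Y ∈ closure {y : Euc m | y ∈ ball (0 : Euc m) R ∧ f (front y) < lastC y} := by
      have h1 : T Y ∈ closure (Ω ∩ ball x R) :=
        inter_comm Ω _ ▸ isOpen_ball.inter_closure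
          ⟨hB (mem_ball_self (by positivity)), hy₀⟩
      rw [hΩ] at h1
      have h2 := T.toHomeomorph.image_closure
        {y : Euc m | y ∈ ball (0 : Euc m) R ∧ f (front y) < lastC y}
      have h3 : T Y ∈ T '' closure
          {y : Euc m | y ∈ ball (0 : Euc m) R ∧ f (front y) < lastC y} := by
        rw [← T.coe_toHomeomorph, h2]; exact h1
      exact (T.injective.mem_set_image).1 h3
    have hc : ContinuousOn (fun y : Euc m => f (front y)) (ball 0 R) :=
      hf.continuousOn.comp continuous_front.continuousOn hfront
    have hne := mem_closure_iff_nhdsWithin_neBot.1 hcl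
    exact le_of_tendsto_of_tendsto
      ((hc Y hY).mono_left (nhdsWithin_mono (s := {y : Euc m | _ ∧ f (front y) < lastC y}) _
        fun y hy => hy.1))
      (continuous_lastC.continuousAt.mono_left nhdsWithin_le_nhds)
      (Filter.eventually_of_mem self_mem_nhdsWithin fun y hy => le_of_lt hy.2)
  set P : Euc m := Y + (ρ / 100) • eLast m with hPdef
  have hPY : dist P Y = ρ / 100 := by
    rw [dist_eq_norm, hPdef, add_sub_cancel_left, norm_smul, norm_eLast, mul_one,
      Real.norm_eq_abs, abs_of_pos (by positivity)]
  have hnear : ∀ w, dist w P < 4 * ρ → w ∈ ball (0 : Euc m) R := by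
    intro w hw
    refine hpre w ?_
    rw [mem_ball, T.dist_eq]
    linarith [dist_triangle w P Y]
  have hP : P ∈ ball (0 : Euc m) R := hnear P (by rw [dist_self]; positivity)
  have hPf : front P = front Y := by
    rw [hPdef, front_add, front_smul, front_eLast, smul_zero, add_zero]
  have lastC_add : ∀ (v w : Euc m) (c : ℝ), lastC (v + c • w) = lastC v + c * lastC w := by
    intro v w c; simp [lastC]
  have hPl : lastC P = lastC Y + ρ / 100 := by
    rw [hPdef, lastC_add, lastC_eLast, mul_one]
  refine ⟨T P, by rw [T.dist_eq, hPY], ?_⟩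
  intro z hz hzP l hl
  obtain ⟨Z, rfl⟩ := T.surjective z
  rw [mem_ball, T.dist_eq] at hzP
  have hZ := hnear Z hzP
  have hZf := (mem_iff Z hZ).1 hz
  rw [← IsometryEquiv.map_add_smul_sub]
  have hcombo : P + l • (Z - P) ∈ ball (0 : Euc m) R :=
    (convex_ball _ _).add_smul_sub_mem hP hZ hl
  rw [mem_iff _ hcombo]
  have efront : front (P + l • (Z - P)) = front P + l • (front Z - front P) := by
    rw [front_add, front_smul, front_sub]
  have elast : lastC (P + l • (Z - P)) = (1 - l) * (lastC Y + ρ / 100) + l * lastC Z := by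
    rw [← hPl]; simp [lastC]; ring
  have key := LipschitzOnWith.apply_combo_le hf (convex_ball _ _) (hfront P hP) (hfront Z hZ) hl
  have hdist : ‖front Z - front P‖ ≤ 4 * ρ := by
    rw [← front_sub]
    exact (norm_front_le _).trans (by rw [← dist_eq_norm]; exact hzP.le)
  have hτd : τ * ‖front Z - front P‖ ≤ ρ / 200 := by
    calc τ * ‖front Z - front P‖ ≤ 1 / 800 * (4 * ρ) := by gcongr
      _ = ρ / 200 := by ring
  rw [efront, elast]
  rw [hPf] at key hτd ⊢
  refine key.trans_lt ?_
  have hl0 := hl.1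
  have hl1 := sub_nonneg.2 hl.2
  have a1 := mul_le_mul_of_nonneg_left hτd (show 0 ≤ 2 * (l * (1 - l)) by positivity)
  have a2 := mul_le_mul_of_nonneg_left hYf hl1
  rcases hl0.eq_or_lt with rfl | hl0'
  · norm_num; linarith
  · have a3 := mul_lt_mul_of_pos_left hZf hl0'
    nlinarith [mul_nonneg (mul_nonneg hl1 hl1) hρ.le]

end Graph

section Extension

theorem harmonicZeroExt_indicator {d : ℕ} {Ω U : Set (Esp d)} (hΩ : IsOpen Ω) (hU : IsOpen U)
    {h : Esp d → ℝ} (hc : ContinuousOn h (closure Ω)) (hh : IsHarmonicOn h Ω)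
    (h0 : ∀ y ∈ frontier Ω ∩ U, h y = 0) : HarmonicZeroExt U Ω (Ω.indicator h) where
  isOpen_dom := hU
  isOpen_set := hΩ
  cont := by
    have hcl : ContinuousOn (Ω.indicator h) (closure Ω ∩ U) := by
      refine (hc.mono inter_subset_left).congr fun y hy => ?_
      by_cases hyΩ : y ∈ Ω
      · rw [indicator_of_mem hyΩ]
      · rw [indicator_of_notMem hyΩ, h0 y ⟨⟨hy.1, by rwa [hΩ.interior_eq]⟩, hy.2⟩]
    have hco : ContinuousOn (Ω.indicator h) (Ωᶜ ∩ U) :=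
      continuousOn_const.congr fun y hy => indicator_of_notMem hy.1 h
    intro y hy
    have hcl' : ContinuousWithinAt (Ω.indicator h) (closure Ω ∩ U) y := by
      by_cases hyΩ : y ∈ closure Ω
      · exact hcl y ⟨hyΩ, hy⟩
      · exact continuousWithinAt_of_notMem_closure fun h' =>
          hyΩ (closure_minimal inter_subset_left isClosed_closure h')
    have hco' : ContinuousWithinAt (Ω.indicator h) (Ωᶜ ∩ U) y := by
      by_cases hyΩ : y ∈ Ωᶜ
      · exact hco y ⟨hyΩ, hy⟩
      · exact continuousWithinAt_of_notMem_closure fun h' =>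
          hyΩ (closure_minimal inter_subset_left hΩ.isClosed_compl h')
    refine (hcl'.union hco').mono fun z hz => ?_
    by_cases hzΩ : z ∈ Ω
    · exact Or.inl ⟨subset_closure hzΩ, hz⟩
    · exact Or.inr ⟨hzΩ, hz⟩
  zero := fun y hy => indicator_of_notMem hy h
  smooth := hh.1.congr fun y hy => indicator_of_mem hy h
  lap_eq := fun y hy => by
    have : Ω.indicator h =ᶠ[nhds y] h :=
      Filter.eventually_of_mem (hΩ.mem_nhds hy) fun z hz => indicator_of_mem hz h
    have e := (this.iteratedFDeriv ℝ 2).eq_of_nhds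
    rw [← hh.2 y hy]
    simp only [lap, e]

end Extension

/-- (Three-ball inequality near the boundary, Lemma 3.4.) There exists
`τ₀ > 0` (depending only on `d = m+1`) such that: if `Ω ⊂ ℝ^d` is a domain, `B = B(x,R)` is
centered on `∂Ω` with `∂Ω ∩ B ∈ Lip(τ)`, `τ < τ₀`, `h` is continuous on `closure Ω`,
harmonic in `Ω`, vanishing on `∂Ω ∩ B`, and `B₀ = B(y₀,ρ)` has center in
`closure Ω ∩ (1/4)B` with `16B₀ ⊆ B`, then
`sup_{(3/2)B₀ ∩ Ω} |h| ≤ 3^d (sup_{B₀ ∩ Ω} |h|)^{1/3} (sup_{4B₀ ∩ Ω} |h|)^{2/3}`. -/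
theorem stmt_8 (m : ℕ) :
    ∃ τ₀ : ℝ≥0, 0 < τ₀ ∧
      ∀ (Ω : Set (Euc m)) (x : Euc m) (R : ℝ) (τ : ℝ≥0),
        IsOpen Ω → IsConnected Ω → x ∈ frontier Ω → 0 < R → 0 < τ → τ < τ₀ →
        LipGraph Ω τ x R →
        ∀ h : Euc m → ℝ, ContinuousOn h (closure Ω) → IsHarmonicOn h Ω →
          (∀ y ∈ frontier Ω ∩ ball x R, h y = 0) →
          ∀ (y₀ : Euc m) (ρ : ℝ), 0 < ρ → y₀ ∈ closure Ω ∩ ball x (R / 4) →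
            ball y₀ (16 * ρ) ⊆ ball x R →
            (⨆ y ∈ ball y₀ (3 / 2 * ρ) ∩ Ω, |h y|) ≤
              3 ^ (m + 1) * (⨆ y ∈ ball y₀ ρ ∩ Ω, |h y|) ^ ((1 : ℝ) / 3) *
                (⨆ y ∈ ball y₀ (4 * ρ) ∩ Ω, |h y|) ^ ((2 : ℝ) / 3) := by
  refine ⟨1 / 800, by positivity, ?_⟩
  intro Ω x R τ hΩ _ _ _ _ hτ hG h hc hh h0 y₀ ρ hρ hy₀ hB
  have hτ' : (τ : ℝ) < 1 / 800 := by exact_mod_cast hτ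
  obtain ⟨p, hp, star⟩ := hG.exists_center hτ' hρ hy₀.1 hB
  have hu := harmonicZeroExt_indicator hΩ isOpen_ball hc hh h0
  have hpU : closedBall p (8 * ρ) ⊆ ball x R := fun z hz => hB <| by
    rw [mem_ball]
    rw [mem_closedBall] at hz
    linarith [dist_triangle z p y₀]
  obtain ⟨C, hC⟩ := ((isCompact_closedBall y₀ (4 * ρ)).inter_right
    (isClosed_closure (s := Ω))).exists_bound_of_continuousOn (hc.mono inter_subset_right)
  have hC4 : ∀ r ≤ 4 * ρ, ∀ y ∈ ball y₀ r ∩ Ω, |h y| ≤ C := fun r hr y hy =>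
    hC y ⟨closedBall_subset_closedBall hr (ball_subset_closedBall hy.1), subset_closure hy.2⟩
  have hM : ∀ r ≤ 4 * ρ, ∀ y ∈ ball y₀ r,
      |Ω.indicator h y| ≤ ⨆ y ∈ ball y₀ r ∩ Ω, |h y| := by
    intro r hr y hy
    by_cases hyΩ : y ∈ Ω
    · rw [indicator_of_mem hyΩ]
      exact abs_le_iSup_mem (hC4 r hr) ⟨hy, hyΩ⟩
    · rw [indicator_of_notMem hyΩ, abs_zero]
      exact iSup_mem_abs_nonneg _ _
  have hM₁ := iSup_mem_abs_nonneg (ball y₀ ρ ∩ Ω) h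
  have hM₄ := iSup_mem_abs_nonneg (ball y₀ (4 * ρ) ∩ Ω) h
  have hrhs : 0 ≤ 3 ^ (m + 1) * (⨆ y ∈ ball y₀ ρ ∩ Ω, |h y|) ^ ((1 : ℝ) / 3) *
      (⨆ y ∈ ball y₀ (4 * ρ) ∩ Ω, |h y|) ^ ((2 : ℝ) / 3) := by positivity
  refine Real.iSup_le (fun y => Real.iSup_le (fun hy => ?_) hrhs) hrhs
  refine le_of_pow_three_le (m + 1) hM₁ hM₄ ?_
  have := hu.abs_pow_three_le (by lia) hρ hp hpU star (hM ρ (by linarith)) (hM _ le_rfl) hy.1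
  rwa [indicator_of_mem hy.2] at this
end
end

section
/- Let Ω ⊂ ℝ^d be a domain and h a function continuous on the closure of Ω and harmonic in Ω, with h = 0 on ∂Ω ∩ B, where B = B(x,r) is a ball centered at x ∈ closure(Ω). Define v = h² on Ω ∩ B and v = 0 on B \ Ω. Then v is subharmonic in B, and consequently for every y ∈ B(x, r/2) ∩ Ω one has h(y)² ≤ |B(y, r/2)|^{-1} ∫_{B(y,r/2) ∩ Ω} h² ≤ |B(y, r/2)|^{-1} ∫_{B(x,r) ∩ Ω} h², where |E| denotes the d-dimensional Lebesgue measure of E. -/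
open Metric MeasureTheory Set
open scoped ENNReal NNReal

noncomputable section

/-- The weight `(1 - |z|²)₊ / 2`, a compactly supported Lipschitz potential of `-z` on the unit
ball. -/
def ballPotential {d : ℕ} (z : EuclideanSpace ℝ (Fin d)) : ℝ := (1 - (min ‖z‖ 1) ^ 2) / 2

section BallPotential

variable {d : ℕ}

lemma ballPotential_nonneg (z : EuclideanSpace ℝ (Fin d)) : 0 ≤ ballPotential z := by
  have h0 : 0 ≤ min ‖z‖ 1 := le_min (norm_nonneg _) zero_le_one
  have h1 : min ‖z‖ 1 ≤ 1 := min_le_right _ _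
  unfold ballPotential
  nlinarith

lemma ballPotential_of_one_le {z : EuclideanSpace ℝ (Fin d)} (hz : 1 ≤ ‖z‖) :
    ballPotential z = 0 := by
  simp [ballPotential, min_eq_right hz]

lemma ballPotential_of_le_one {z : EuclideanSpace ℝ (Fin d)} (hz : ‖z‖ ≤ 1) :
    ballPotential z = (1 - ‖z‖ ^ 2) / 2 := by
  simp [ballPotential, min_eq_left hz]

lemma lipschitzWith_ballPotential :
    LipschitzWith 1 (ballPotential : EuclideanSpace ℝ (Fin d) → ℝ) := by
  refine LipschitzWith.of_dist_le_mul fun z w => ?_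
  have hz0 : 0 ≤ min ‖z‖ 1 := le_min (norm_nonneg _) zero_le_one
  have hz1 : min ‖z‖ 1 ≤ 1 := min_le_right _ _
  have hw0 : 0 ≤ min ‖w‖ 1 := le_min (norm_nonneg _) zero_le_one
  have hw1 : min ‖w‖ 1 ≤ 1 := min_le_right _ _
  have hlip : |min ‖z‖ 1 - min ‖w‖ 1| ≤ dist z w := by
    refine (abs_min_sub_min_le_max _ _ _ _).trans ?_
    simpa [dist_eq_norm] using abs_norm_sub_norm_le z w
  rw [NNReal.coe_one, one_mul, Real.dist_eq]
  unfold ballPotential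
  have hfac : (1 - (min ‖z‖ 1) ^ 2) / 2 - (1 - (min ‖w‖ 1) ^ 2) / 2 =
      -((min ‖z‖ 1 + min ‖w‖ 1) / 2 * (min ‖z‖ 1 - min ‖w‖ 1)) := by ring
  rw [hfac, abs_neg, abs_mul, abs_of_nonneg (by positivity)]
  nlinarith [abs_nonneg (min ‖z‖ 1 - min ‖w‖ 1)]

lemma hasCompactSupport_ballPotential :
    HasCompactSupport (ballPotential : EuclideanSpace ℝ (Fin d) → ℝ) := by
  refine HasCompactSupport.intro (isCompact_closedBall 0 1) fun z hz => ?_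
  refine ballPotential_of_one_le ?_
  simp only [mem_closedBall, dist_zero_right, not_le] at hz
  exact hz.le

lemma lineDeriv_ballPotential_of_mem_ball {z : EuclideanSpace ℝ (Fin d)} (hz : z ∈ ball 0 1)
    (w : EuclideanSpace ℝ (Fin d)) :
    lineDeriv ℝ ballPotential z (-w) = inner ℝ z w := by
  have hev : ballPotential =ᶠ[nhds z] fun u => (1 - ‖u‖ ^ 2) * 2⁻¹ := by
    filter_upwards [isOpen_ball.mem_nhds hz] with u hu
    exact ballPotential_of_le_one (by simpa using (mem_ball.1 hu).le)
  have hd := ((hasStrictFDerivAt_norm_sq z).hasFDerivAt.const_sub 1).mul_const (2 : ℝ)⁻¹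
  rw [hev.lineDeriv_eq, (hd.hasLineDerivAt _).lineDeriv]
  simp

lemma lineDeriv_ballPotential_of_notMem_closedBall {z : EuclideanSpace ℝ (Fin d)}
    (hz : z ∉ closedBall 0 1) (w : EuclideanSpace ℝ (Fin d)) :
    lineDeriv ℝ ballPotential z w = 0 := by
  have hev : ballPotential =ᶠ[nhds z] fun _ => (0 : ℝ) := by
    filter_upwards [isClosed_closedBall.isOpen_compl.mem_nhds hz] with u hu
    refine ballPotential_of_one_le ?_
    simp only [mem_compl_iff, mem_closedBall, dist_zero_right, not_le] at hu
    exact hu.le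
  rw [hev.lineDeriv_eq]
  simp [lineDeriv]

/-- Integration by parts on the unit ball against the field `z`. -/
lemma setIntegral_ball_inner_mul {f : EuclideanSpace ℝ (Fin d) → ℝ} {C : ℝ≥0}
    (hf : LipschitzWith C f) (w : EuclideanSpace ℝ (Fin d)) :
    ∫ z in ball (0 : EuclideanSpace ℝ (Fin d)) 1, inner ℝ z w * f z =
      ∫ z, lineDeriv ℝ f z w * ballPotential z := by
  rw [LipschitzWith.integral_lineDeriv_mul_eq hf lipschitzWith_ballPotential
    hasCompactSupport_ballPotential, ← integral_indicator measurableSet_ball]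
  refine integral_congr_ae ?_
  have hsph : ∀ᵐ z : EuclideanSpace ℝ (Fin d), z ∉ sphere 0 1 :=
    measure_eq_zero_iff_ae_notMem.1 (Measure.addHaar_sphere_of_ne_zero _ _ one_ne_zero)
  filter_upwards [hsph] with z hz
  by_cases hb : z ∈ ball 0 1
  · rw [indicator_of_mem hb, lineDeriv_ballPotential_of_mem_ball hb]
  · have hc : z ∉ closedBall (0 : EuclideanSpace ℝ (Fin d)) 1 := by
      rw [← ball_union_sphere]
      exact fun h => h.elim hb hz
    rw [indicator_of_notMem hb, lineDeriv_ballPotential_of_notMem_closedBall hc, zero_mul]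

end BallPotential

section MeanValue

variable {d : ℕ}

lemma lap_eq_sum_fderiv (u : EuclideanSpace ℝ (Fin d) → ℝ) (z : EuclideanSpace ℝ (Fin d)) :
    lap u z = ∑ i : Fin d, fderiv ℝ (fderiv ℝ u) z (EuclideanSpace.single i 1)
      (EuclideanSpace.single i 1) := by
  simp [lap, iteratedFDeriv_two_apply]

lemma Filter.EventuallyEq.lap_eq {u v : EuclideanSpace ℝ (Fin d) → ℝ}
    {z : EuclideanSpace ℝ (Fin d)} (h : u =ᶠ[nhds z] v) : lap u z = lap v z := by
  simp only [lap_eq_sum_fderiv, h.fderiv.fderiv_eq]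

/-- The radial derivative of a `C²` function with nonnegative Laplacian has nonnegative integral
over the ball, here rescaled to the unit ball. -/
lemma setIntegral_ball_fderiv_nonneg {u : EuclideanSpace ℝ (Fin d) → ℝ} (hu : ContDiff ℝ 2 u)
    (hsupp : HasCompactSupport u) {y : EuclideanSpace ℝ (Fin d)} {t : ℝ} (ht : 0 ≤ t)
    (hlap : ∀ z ∈ ball y t, 0 ≤ lap u z) :
    0 ≤ ∫ z in ball (0 : EuclideanSpace ℝ (Fin d)) 1, fderiv ℝ u (y + t • z) z := by
  have hu1 : ContDiff ℝ 1 (fderiv ℝ u) := hu.fderiv_right (by norm_num)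
  obtain ⟨C, hC⟩ := ContDiff.lipschitzWith_of_hasCompactSupport (hsupp.fderiv ℝ) hu1 one_ne_zero
  set e : Fin d → EuclideanSpace ℝ (Fin d) := fun i => EuclideanSpace.single i 1 with he
  set D2 : Fin d → EuclideanSpace ℝ (Fin d) → ℝ :=
    fun i z => fderiv ℝ (fderiv ℝ u) (y + t • z) (e i) (e i) with hD2
  have hcont1 : Continuous (fderiv ℝ u) := hu1.continuous
  have hcont2 : Continuous (fderiv ℝ (fderiv ℝ u)) := hu1.continuous_fderiv one_ne_zero
  have hlipi : ∀ i, ∃ K, LipschitzWith K (fun z => fderiv ℝ u (y + t • z) (e i)) := fun i => by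
    have h1 : LipschitzWith (0 + ‖t‖₊) (fun z : EuclideanSpace ℝ (Fin d) => y + t • z) :=
      (LipschitzWith.const y).add (lipschitzWith_smul t)
    exact ⟨_, ((ContinuousLinearMap.apply ℝ ℝ (e i)).lipschitz).comp (hC.comp h1)⟩
  have hline : ∀ i z, lineDeriv ℝ (fun z => fderiv ℝ u (y + t • z) (e i)) z (e i) =
      t * D2 i z := fun i z => by
    have h1 : HasFDerivAt (fun z : EuclideanSpace ℝ (Fin d) => y + t • z)
        (t • ContinuousLinearMap.id ℝ _) z :=
      ((hasFDerivAt_id z).const_smul t).const_add y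
    have h2 := ((hu1.differentiable one_ne_zero) (y + t • z)).hasFDerivAt.comp z h1
    have h3 := ((ContinuousLinearMap.apply ℝ ℝ (e i)).hasFDerivAt).comp z h2
    have := (h3.hasLineDerivAt (e i)).lineDeriv
    simpa [hD2, Function.comp_def] using this
  have hexp : ∀ z, fderiv ℝ u (y + t • z) z =
      ∑ i, inner ℝ z (e i) * fderiv ℝ u (y + t • z) (e i) := fun z => by
    have hz : z = ∑ i, z i • e i := by
      ext j
      simp [he, Pi.single_apply]
    conv_lhs => rw [hz, map_sum, ← hz]
    simp [he, EuclideanSpace.inner_single_right]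
  have hint : ∀ i, IntegrableOn (fun z => inner ℝ z (e i) * fderiv ℝ u (y + t • z) (e i))
      (ball 0 1) := fun i => by
    refine (Continuous.continuousOn ?_).integrableOn_compact (isCompact_closedBall 0 1)
      |>.mono_set ball_subset_closedBall
    fun_prop
  have hint2 : ∀ i, Integrable (fun z => t * D2 i z * ballPotential z) := fun i => by
    refine Continuous.integrable_of_hasCompactSupport ?_ hasCompactSupport_ballPotential.mul_left
    have := (lipschitzWith_ballPotential (d := d)).continuous
    fun_prop
  simp_rw [hexp]
  rw [integral_finsetSum _ fun i _ => hint i]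
  have hparts : ∀ i, ∫ z in ball (0 : EuclideanSpace ℝ (Fin d)) 1,
      inner ℝ z (e i) * fderiv ℝ u (y + t • z) (e i) = ∫ z, t * D2 i z * ballPotential z :=
    fun i => by
      obtain ⟨K, hK⟩ := hlipi i
      rw [setIntegral_ball_inner_mul hK]
      simp_rw [hline]
  simp_rw [hparts]
  rw [← integral_finsetSum _ fun i _ => hint2 i]
  refine integral_nonneg fun z => ?_
  simp only [Pi.zero_apply]
  rw [← Finset.sum_mul, ← Finset.mul_sum]
  by_cases hz : ‖z‖ < 1
  · rcases ht.eq_or_lt with rfl | htpos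
    · simp
    have hmem : y + t • z ∈ ball y t := by
      simp only [mem_ball, dist_self_add_left, norm_smul, Real.norm_eq_abs, abs_of_pos htpos]
      nlinarith
    have := hlap _ hmem
    rw [lap_eq_sum_fderiv] at this
    exact mul_nonneg (mul_nonneg ht this) (ballPotential_nonneg z)
  · rw [ballPotential_of_one_le (not_lt.1 hz), mul_zero]

lemma setIntegral_ball_comp_add_smul (u : EuclideanSpace ℝ (Fin d) → ℝ)
    (y : EuclideanSpace ℝ (Fin d)) {R : ℝ} (hR : 0 < R) :
    ∫ z in ball (0 : EuclideanSpace ℝ (Fin d)) 1, u (y + R • z) =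
      (R ^ d)⁻¹ * ∫ z in ball y R, u z := by
  rw [Measure.setIntegral_comp_smul_of_pos volume (fun z => u (y + z)) _ hR,
    smul_unitBall_of_pos hR, finrank_euclideanSpace_fin, smul_eq_mul,
    ← (measurePreserving_add_left volume y).setIntegral_preimage_emb
      (measurableEmbedding_addLeft y) u (ball y R)]
  congr 3
  ext z
  simp

/-- Sub-mean-value inequality for compactly supported `C²` functions. -/
lemma mul_volume_ball_le_of_hasCompactSupport {u : EuclideanSpace ℝ (Fin d) → ℝ}
    (hu : ContDiff ℝ 2 u) (hsupp : HasCompactSupport u) {y : EuclideanSpace ℝ (Fin d)} {R : ℝ}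
    (hR : 0 < R) (hlap : ∀ z ∈ ball y R, 0 ≤ lap u z) :
    u y * (volume (ball y R)).toReal ≤ ∫ z in ball y R, u z := by
  set B : Set (EuclideanSpace ℝ (Fin d)) := ball 0 1 with hB
  set M : ℝ → ℝ := fun t => ∫ z in B, u (y + t • z) with hM
  have hcont1 : Continuous (fderiv ℝ u) := hu.continuous_fderiv two_ne_zero
  have hcont : Continuous u := hu.continuous
  obtain ⟨C, hC⟩ := (hsupp.fderiv ℝ).exists_bound_of_continuous hcont1
  have hderiv : ∀ t, HasDerivAt M (∫ z in B, fderiv ℝ u (y + t • z) z) t := fun t => by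
    refine (hasDerivAt_integral_of_dominated_loc_of_deriv_le (𝕜 := ℝ)
      (F := fun t z => u (y + t • z)) (F' := fun t z => fderiv ℝ u (y + t • z) z)
      (bound := fun _ => C) (s := univ) Filter.univ_mem ?_ ?_ ?_ ?_ ?_ ?_).2
    · exact Filter.Eventually.of_forall fun s => Continuous.aestronglyMeasurable (by fun_prop)
    · refine (Continuous.continuousOn ?_).integrableOn_compact (isCompact_closedBall 0 1)
        |>.mono_set ball_subset_closedBall
      fun_prop
    · exact Continuous.aestronglyMeasurable (by fun_prop)
    · filter_upwards [ae_restrict_mem measurableSet_ball] with z hz s _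
      have hz1 : ‖z‖ ≤ 1 := by simpa using (mem_ball.1 hz).le
      calc ‖fderiv ℝ u (y + s • z) z‖ ≤ ‖fderiv ℝ u (y + s • z)‖ * ‖z‖ :=
            ContinuousLinearMap.le_opNorm _ _
        _ ≤ C * 1 := mul_le_mul (hC _) hz1 (norm_nonneg _) ((norm_nonneg _).trans (hC 0))
        _ = C := mul_one C
    · exact integrableOn_const measure_ball_lt_top.ne
    · refine Filter.Eventually.of_forall fun z s _ => ?_
      have h1 : HasDerivAt (fun s : ℝ => y + s • z) z s := by
        simpa using ((hasDerivAt_id s).smul_const z).const_add y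
      exact ((hu.differentiable two_ne_zero) (y + s • z)).hasFDerivAt.comp_hasDerivAt s h1
  have hmono : MonotoneOn M (Icc 0 R) := by
    refine monotoneOn_of_deriv_nonneg (convex_Icc 0 R)
      (fun t _ => (hderiv t).continuousAt.continuousWithinAt)
      (fun t _ => (hderiv t).differentiableAt.differentiableWithinAt) fun t ht => ?_
    rw [interior_Icc] at ht
    rw [(hderiv t).deriv]
    exact setIntegral_ball_fderiv_nonneg hu hsupp ht.1.le fun z hz =>
      hlap z (ball_subset_ball ht.2.le hz)
  have hle : M 0 ≤ M R := hmono ⟨le_rfl, hR.le⟩ ⟨hR.le, le_rfl⟩ hR.le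
  have hM0 : M 0 = u y * (volume B).toReal := by
    simp [hM, Measure.real, mul_comm]
  have hMR : M R = (R ^ d)⁻¹ * ∫ z in ball y R, u z := setIntegral_ball_comp_add_smul u y hR
  have hvol : (volume (ball y R)).toReal = R ^ d * (volume B).toReal := by
    rw [Measure.addHaar_ball_of_pos volume y hR, finrank_euclideanSpace_fin, ENNReal.toReal_mul,
      ENNReal.toReal_ofReal (by positivity)]
  rw [hM0, hMR] at hle
  rw [hvol]
  have hRd : 0 < R ^ d := by positivity
  rw [inv_mul_eq_div, le_div_iff₀ hRd] at hle
  linarith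

/-- Sub-mean-value inequality for `C²` functions with nonnegative Laplacian, on compactly
contained balls. -/
lemma mul_volume_ball_le_of_contDiffOn {u : EuclideanSpace ℝ (Fin d) → ℝ}
    {y : EuclideanSpace ℝ (Fin d)} {R ρ : ℝ} (hR : 0 < R) (hRρ : R < ρ)
    (hu : ∀ z ∈ ball y ρ, ContDiffAt ℝ 2 u z) (hlap : ∀ z ∈ ball y R, 0 ≤ lap u z) :
    u y * (volume (ball y R)).toReal ≤ ∫ z in ball y R, u z := by
  let f : ContDiffBump y := ⟨R, (R + ρ) / 2, hR, by linarith⟩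
  have hsub : tsupport f ⊆ ball y ρ := by
    rw [f.tsupport_eq]
    exact closedBall_subset_ball (show (R + ρ) / 2 < ρ by linarith)
  have hfu : ContDiff ℝ 2 (fun z => f z * u z) := by
    rw [contDiff_iff_contDiffAt]
    intro z
    by_cases hz : z ∈ tsupport f
    · exact f.contDiffAt.mul (hu z (hsub hz))
    · have : (fun z => f z * u z) =ᶠ[nhds z] fun _ => (0 : ℝ) := by
        filter_upwards [notMem_tsupport_iff_eventuallyEq.1 hz] with w hw
        simp [hw]
      exact contDiffAt_const.congr_of_eventuallyEq this
  have heq : ∀ z ∈ ball y R, f z * u z = u z := fun z hz => by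
    rw [f.one_of_mem_closedBall (ball_subset_closedBall hz), one_mul]
  have key := mul_volume_ball_le_of_hasCompactSupport hfu
    (f.hasCompactSupport.mul_right (f' := u)) hR fun z hz => by
      have : (fun z => f z * u z) =ᶠ[nhds z] u := by
        filter_upwards [isOpen_ball.mem_nhds hz] with w hw using heq w hw
      rw [this.lap_eq]
      exact hlap z hz
  rwa [setIntegral_congr_fun measurableSet_ball heq, heq y (mem_ball_self hR)] at key

end MeanValue

section Truncation

/-- A smooth convex truncation of the identity at height `ε`. -/
lemma exists_convex_truncation {ε : ℝ} (hε : 0 < ε) :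
    ∃ φ : ℝ → ℝ, ContDiff ℝ 2 φ ∧ (∀ t, 0 ≤ deriv φ t) ∧ (∀ t, 0 ≤ deriv (deriv φ) t) ∧
      (∀ t ≤ ε, φ t = 0) ∧ ∀ t, 0 ≤ t → t - 2 * ε ≤ φ t ∧ φ t ≤ t := by
  set g : ℝ → ℝ := fun s => Real.smoothTransition ((s - ε) / ε) with hg
  have hgs : ContDiff ℝ 1 g :=
    (Real.smoothTransition.contDiff (n := 1)).comp ((contDiff_id.sub contDiff_const).div_const ε)
  have hgc : Continuous g := hgs.continuous
  have hgm : Monotone g := fun a b hab => Real.smoothTransition.monotone (by gcongr)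
  have hgi : ∀ a b, IntervalIntegrable g volume a b := fun a b => hgc.intervalIntegrable a b
  have hg0 : ∀ s ≤ ε, g s = 0 := fun s hs =>
    Real.smoothTransition.zero_of_nonpos (div_nonpos_of_nonpos_of_nonneg (by linarith) hε.le)
  have hg1 : ∀ s, 2 * ε ≤ s → g s = 1 := fun s hs =>
    Real.smoothTransition.one_of_one_le ((one_le_div hε).2 (by linarith))
  have hd : ∀ t, HasDerivAt (fun t => ∫ s in ε..t, g s) (g t) t := fun t =>
    intervalIntegral.integral_hasDerivAt_right (hgi _ _)
      hgc.stronglyMeasurable.stronglyMeasurableAtFilter hgc.continuousAt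
  have hderiv : deriv (fun t => ∫ s in ε..t, g s) = g := funext fun t => (hd t).deriv
  have hzero : ∀ t ≤ ε, ∫ s in ε..t, g s = 0 := fun t ht => by
    rw [intervalIntegral.integral_congr (g := fun _ => 0) fun s hs => hg0 s ?_]
    · simp
    · rw [uIcc_of_ge ht] at hs
      exact hs.2
  refine ⟨fun t => ∫ s in ε..t, g s, ?_, fun t => ?_, fun t => ?_, hzero, fun t ht => ⟨?_, ?_⟩⟩
  · rw [show (2 : WithTop ℕ∞) = 1 + 1 by norm_num, contDiff_succ_iff_deriv]
    exact ⟨fun t => (hd t).differentiableAt, by simp, by rwa [hderiv]⟩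
  · rw [hderiv]
    exact Real.smoothTransition.nonneg _
  · rw [hderiv]
    exact hgm.deriv_nonneg
  · have hpos : ∀ b, ε ≤ b → 0 ≤ ∫ s in ε..b, g s := fun b hb =>
      intervalIntegral.integral_nonneg hb fun s _ => Real.smoothTransition.nonneg _
    rcases le_total t (2 * ε) with h2 | h2
    · rcases le_total t ε with h1 | h1
      · simp only [hzero t h1]
        linarith
      · linarith [hpos t h1]
    · have hsplit := intervalIntegral.integral_add_adjacent_intervals (hgi ε (2 * ε)) (hgi (2 * ε) t)
      have hlin : ∫ s in (2 * ε)..t, g s = t - 2 * ε := by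
        rw [intervalIntegral.integral_congr (g := fun _ => 1) fun s hs => hg1 s ?_]
        · simp
        · rw [uIcc_of_le h2] at hs
          exact hs.1
      linarith [hpos (2 * ε) (by linarith)]
  · rcases le_total t ε with h1 | h1
    · simp only [hzero t h1]
      exact ht
    · have : ∫ s in ε..t, g s ≤ ∫ _ in ε..t, (1 : ℝ) :=
        intervalIntegral.integral_mono_on h1 (hgi _ _) (by simp)
          fun s _ => Real.smoothTransition.le_one _
      simp only [intervalIntegral.integral_const, smul_eq_mul, mul_one] at this
      linarith

/-- A convex `C²` approximation of the square vanishing near the origin. -/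
lemma exists_convex_truncation_sq {ε : ℝ} (hε : 0 < ε) :
    ∃ ψ : ℝ → ℝ, ContDiff ℝ 2 ψ ∧ (∀ s, 0 ≤ deriv (deriv ψ) s) ∧
      (∀ s, s ^ 2 ≤ ε → ψ s = 0) ∧ ∀ s, s ^ 2 - 2 * ε ≤ ψ s ∧ ψ s ≤ s ^ 2 := by
  obtain ⟨φ, hφ, hφ1, hφ2, hφ0, hφb⟩ := exists_convex_truncation hε
  have hφ' : ContDiff ℝ 1 (deriv φ) := by
    rw [show (2 : WithTop ℕ∞) = 1 + 1 by norm_num, contDiff_succ_iff_deriv] at hφ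
    exact hφ.2.2
  have hsq : ∀ s : ℝ, HasDerivAt (fun s : ℝ => s ^ 2) (2 * s) s := fun s => by
    simpa using hasDerivAt_pow 2 s
  have hd : deriv (fun s => φ (s ^ 2)) = fun s => deriv φ (s ^ 2) * (2 * s) := funext fun s =>
    ((hφ.differentiable two_ne_zero (s ^ 2)).hasDerivAt.comp s (hsq s)).deriv
  refine ⟨fun s => φ (s ^ 2), hφ.comp (contDiff_id.pow 2), fun s => ?_, fun s hs => hφ0 _ hs,
    fun s => hφb _ (sq_nonneg s)⟩
  have hd2 : HasDerivAt (fun s => deriv φ (s ^ 2) * (2 * s))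
      (deriv (deriv φ) (s ^ 2) * (2 * s) * (2 * s) + deriv φ (s ^ 2) * 2) s := by
    have h1 := (hφ'.differentiable one_ne_zero (s ^ 2)).hasDerivAt.comp s (hsq s)
    exact h1.mul (by simpa using (hasDerivAt_id s).const_mul 2)
  rw [hd, hd2.deriv]
  have h1 := mul_nonneg (hφ2 (s ^ 2)) (sq_nonneg (2 * s))
  have h2 := hφ1 (s ^ 2)
  nlinarith

/-- A convex `C²` function of a harmonic function has nonnegative Laplacian. -/
lemma lap_comp_nonneg {d : ℕ} {h : EuclideanSpace ℝ (Fin d) → ℝ} {z : EuclideanSpace ℝ (Fin d)}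
    (hh : ContDiffAt ℝ 2 h z) (hlap : lap h z = 0) {ψ : ℝ → ℝ} (hψ : ContDiff ℝ 2 ψ)
    (hconv : 0 ≤ deriv (deriv ψ) (h z)) :
    0 ≤ lap (fun w => ψ (h w)) z := by
  have hψ' : ContDiff ℝ 1 (deriv ψ) := by
    rw [show (2 : WithTop ℕ∞) = 1 + 1 by norm_num, contDiff_succ_iff_deriv] at hψ
    exact hψ.2.2
  have hev : fderiv ℝ (fun w => ψ (h w)) =ᶠ[nhds z] fun w => deriv ψ (h w) • fderiv ℝ h w := by
    filter_upwards [hh.eventually (by simp)] with w hw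
    exact ((hψ.differentiable two_ne_zero (h w)).hasDerivAt.comp_hasFDerivAt w
      (hw.differentiableAt two_ne_zero).hasFDerivAt).fderiv
  have hD : HasFDerivAt (fun w => deriv ψ (h w) • fderiv ℝ h w) _ z :=
    ((hψ'.differentiable one_ne_zero (h z)).hasDerivAt.comp_hasFDerivAt z
      (hh.differentiableAt two_ne_zero).hasFDerivAt).smul
      ((hh.fderiv_right (m := 1) (by norm_num)).differentiableAt one_ne_zero).hasFDerivAt
  rw [lap_eq_sum_fderiv, hev.fderiv_eq, hD.fderiv]
  rw [lap_eq_sum_fderiv] at hlap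
  simp only [_root_.add_apply, _root_.smul_apply,
    ContinuousLinearMap.smulRight_apply, smul_eq_mul]
  rw [Finset.sum_add_distrib, ← Finset.mul_sum, hlap, mul_zero, zero_add]
  refine Finset.sum_nonneg fun i _ => ?_
  rw [mul_assoc]
  exact mul_nonneg hconv (mul_self_nonneg _)

end Truncation

section SquareExtension

variable {d : ℕ}

/-- The extension by zero of the square of a function vanishing on the boundary is continuous. -/
lemma continuousAt_indicator_sq {Ω : Set (EuclideanSpace ℝ (Fin d))} (hΩ : IsOpen Ω)
    {h : EuclideanSpace ℝ (Fin d) → ℝ} (hcont : ContinuousOn h (closure Ω))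
    {z : EuclideanSpace ℝ (Fin d)} (hz : z ∈ frontier Ω → h z = 0) :
    ContinuousAt (Ω.indicator fun w => h w ^ 2) z := by
  by_cases hzc : z ∈ closure Ω
  · by_cases hzΩ : z ∈ Ω
    · have hc : ContinuousAt (fun w => h w ^ 2) z :=
        ((hcont z hzc).continuousAt (Filter.mem_of_superset (hΩ.mem_nhds hzΩ) subset_closure)).pow 2
      refine hc.congr ?_
      filter_upwards [hΩ.mem_nhds hzΩ] with w hw
      rw [indicator_of_mem hw]
    · have hz0 : h z = 0 := hz (hΩ.frontier_eq ▸ ⟨hzc, hzΩ⟩)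
      have hc : Filter.Tendsto (fun w => h w ^ 2) (nhdsWithin z Ω) (nhds 0) := by
        simpa [hz0] using Filter.Tendsto.pow ((hcont z hzc).mono subset_closure) 2
      rw [ContinuousAt, indicator_of_notMem hzΩ]
      rw [← nhdsWithin_univ, ← union_compl_self Ω, nhdsWithin_union]
      refine Filter.Tendsto.sup (hc.congr' ?_) (tendsto_const_nhds.congr' ?_)
      · filter_upwards [self_mem_nhdsWithin] with w hw
        rw [indicator_of_mem hw]
      · filter_upwards [self_mem_nhdsWithin] with w hw
        rw [indicator_of_notMem hw]
  · have hev : (fun _ => (0 : ℝ)) =ᶠ[nhds z] Ω.indicator fun w => h w ^ 2 := by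
      filter_upwards [isClosed_closure.isOpen_compl.mem_nhds hzc] with w hw
      rw [indicator_of_notMem fun hwΩ => hw (subset_closure hwΩ)]
    exact continuousAt_const.congr hev

lemma integrableOn_sq_ball_inter {Ω : Set (EuclideanSpace ℝ (Fin d))}
    {h : EuclideanSpace ℝ (Fin d) → ℝ} (hcont : ContinuousOn h (closure Ω))
    (x : EuclideanSpace ℝ (Fin d)) (r : ℝ) :
    IntegrableOn (fun z => h z ^ 2) (ball x r ∩ Ω) := by
  have hK : IsCompact (closedBall x r ∩ closure Ω) :=
    (isCompact_closedBall x r).inter_right isClosed_closure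
  exact (((hcont.mono inter_subset_right).pow 2).integrableOn_compact hK).mono_set
    (inter_subset_inter ball_subset_closedBall subset_closure)

lemma integrableOn_indicator_sq_ball {Ω : Set (EuclideanSpace ℝ (Fin d))} (hΩ : IsOpen Ω)
    {h : EuclideanSpace ℝ (Fin d) → ℝ} (hcont : ContinuousOn h (closure Ω))
    (x : EuclideanSpace ℝ (Fin d)) (r : ℝ) :
    IntegrableOn (Ω.indicator fun z => h z ^ 2) (ball x r) := by
  rw [IntegrableOn, integrable_indicator_iff hΩ.measurableSet, IntegrableOn,
    Measure.restrict_restrict hΩ.measurableSet, inter_comm]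
  exact integrableOn_sq_ball_inter hcont x r

/-- Sub-mean-value inequality for the extension by zero of `h²` on compactly contained balls. -/
lemma indicator_sq_mul_volume_ball_le {Ω : Set (EuclideanSpace ℝ (Fin d))} (hΩ : IsOpen Ω)
    {h : EuclideanSpace ℝ (Fin d) → ℝ} (hcont : ContinuousOn h (closure Ω))
    (hharm : IsHarmonicOn h Ω) {y : EuclideanSpace ℝ (Fin d)} {R ρ : ℝ} (hR : 0 < R)
    (hRρ : R < ρ) (hzero : ∀ z ∈ frontier Ω ∩ ball y ρ, h z = 0) :
    Ω.indicator (fun z => h z ^ 2) y * (volume (ball y R)).toReal ≤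
      ∫ z in ball y R, Ω.indicator (fun w => h w ^ 2) z := by
  set v : EuclideanSpace ℝ (Fin d) → ℝ := Ω.indicator fun z => h z ^ 2 with hv
  have hV : 0 < (volume (ball y R)).toReal :=
    ENNReal.toReal_pos (measure_ball_pos _ _ hR).ne' measure_ball_lt_top.ne
  refine le_of_forall_pos_le_add fun δ hδ => ?_
  set ε : ℝ := δ / (2 * (volume (ball y R)).toReal) with hε
  have hεpos : 0 < ε := by positivity
  obtain ⟨ψ, hψ, hψ2, hψ0, hψb⟩ := exists_convex_truncation_sq hεpos
  set u : EuclideanSpace ℝ (Fin d) → ℝ := Ω.indicator fun z => ψ (h z) with hu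
  have hinside : ∀ z ∈ Ω, u =ᶠ[nhds z] fun w => ψ (h w) := fun z hz => by
    filter_upwards [hΩ.mem_nhds hz] with w hw
    rw [hu, indicator_of_mem hw]
  have houtside : ∀ z ∈ ball y ρ, z ∉ Ω → u =ᶠ[nhds z] fun _ => 0 := fun z hz hzΩ => by
    have hc : ContinuousAt v z :=
      continuousAt_indicator_sq hΩ hcont fun hzf => hzero z ⟨hzf, hz⟩
    have hvz : v z < ε := by rwa [hv, indicator_of_notMem hzΩ]
    filter_upwards [hc.eventually (gt_mem_nhds hvz)] with w hw
    by_cases hwΩ : w ∈ Ω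
    · rw [hv, indicator_of_mem hwΩ] at hw
      rw [hu, indicator_of_mem hwΩ, hψ0 _ hw.le]
    · rw [hu, indicator_of_notMem hwΩ]
  have hhC : ∀ z ∈ Ω, ContDiffAt ℝ 2 h z := fun z hz => hharm.1.contDiffAt (hΩ.mem_nhds hz)
  have huC : ∀ z ∈ ball y ρ, ContDiffAt ℝ 2 u z := fun z hz => by
    by_cases hzΩ : z ∈ Ω
    · exact (hψ.contDiffAt.comp z (hhC z hzΩ)).congr_of_eventuallyEq (hinside z hzΩ)
    · exact contDiffAt_const.congr_of_eventuallyEq (houtside z hz hzΩ)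
  have hulap : ∀ z ∈ ball y R, 0 ≤ lap u z := fun z hz => by
    by_cases hzΩ : z ∈ Ω
    · rw [(hinside z hzΩ).lap_eq]
      exact lap_comp_nonneg (hhC z hzΩ) (hharm.2 z hzΩ) hψ (hψ2 _)
    · rw [(houtside z (ball_subset_ball hRρ.le hz) hzΩ).lap_eq]
      simp [lap_eq_sum_fderiv]
  have hmean := mul_volume_ball_le_of_contDiffOn hR hRρ huC hulap
  have huv : ∀ z, v z - 2 * ε ≤ u z ∧ u z ≤ v z := fun z => by
    by_cases hzΩ : z ∈ Ω
    · rw [hu, hv, indicator_of_mem hzΩ, indicator_of_mem hzΩ]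
      exact hψb (h z)
    · rw [hu, hv, indicator_of_notMem hzΩ, indicator_of_notMem hzΩ]
      exact ⟨by linarith, le_rfl⟩
  have huI : IntegrableOn u (ball y R) := by
    refine (ContinuousOn.integrableOn_compact (isCompact_closedBall y R) fun z hz => ?_).mono_set
      ball_subset_closedBall
    exact (huC z (closedBall_subset_ball hRρ hz)).continuousAt.continuousWithinAt
  have hmono : ∫ z in ball y R, u z ≤ ∫ z in ball y R, v z :=
    setIntegral_mono huI (integrableOn_indicator_sq_ball hΩ hcont y R) fun z => (huv z).2
  have hδε : 2 * ε * (volume (ball y R)).toReal = δ := by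
    rw [hε]
    field_simp
  nlinarith [mul_le_mul_of_nonneg_right (huv y).1 hV.le]

/-- The extension by zero of `h²` satisfies the sub-mean-value inequality. -/
lemma indicator_sq_le_average {Ω : Set (EuclideanSpace ℝ (Fin d))} (hΩ : IsOpen Ω)
    {h : EuclideanSpace ℝ (Fin d) → ℝ} (hcont : ContinuousOn h (closure Ω))
    (hharm : IsHarmonicOn h Ω) {y : EuclideanSpace ℝ (Fin d)} {ρ : ℝ} (hρ : 0 < ρ)
    (hzero : ∀ z ∈ frontier Ω ∩ ball y ρ, h z = 0) :
    Ω.indicator (fun z => h z ^ 2) y ≤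
      (∫ z in ball y ρ, Ω.indicator (fun w => h w ^ 2) z) / (volume (ball y ρ)).toReal := by
  set v : EuclideanSpace ℝ (Fin d) → ℝ := Ω.indicator fun z => h z ^ 2 with hv
  have hv0 : ∀ z, 0 ≤ v z := fun z => indicator_nonneg (fun w _ => sq_nonneg (h w)) z
  have hvol : ∀ R, 0 < R → (volume (ball y R)).toReal =
      R ^ d * (volume (ball (0 : EuclideanSpace ℝ (Fin d)) 1)).toReal := fun R hR => by
    rw [Measure.addHaar_ball_of_pos volume y hR, finrank_euclideanSpace_fin, ENNReal.toReal_mul,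
      ENNReal.toReal_ofReal (by positivity)]
  have hV : 0 < (volume (ball y ρ)).toReal :=
    ENNReal.toReal_pos (measure_ball_pos _ _ hρ).ne' measure_ball_lt_top.ne
  rw [le_div_iff₀ hV, hvol ρ hρ]
  have hlim : Filter.Tendsto
      (fun R : ℝ => v y * (R ^ d * (volume (ball (0 : EuclideanSpace ℝ (Fin d)) 1)).toReal))
      (nhdsWithin ρ (Iio ρ))
      (nhds (v y * (ρ ^ d * (volume (ball (0 : EuclideanSpace ℝ (Fin d)) 1)).toReal))) :=
    (Continuous.tendsto (by fun_prop) ρ).mono_left nhdsWithin_le_nhds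
  refine le_of_tendsto hlim ?_
  filter_upwards [Ioo_mem_nhdsLT hρ] with R hR
  rw [← hvol R hR.1]
  exact (indicator_sq_mul_volume_ball_le hΩ hcont hharm hR.1 hR.2 hzero).trans
    (setIntegral_mono_set (integrableOn_indicator_sq_ball hΩ hcont y ρ)
      (Filter.Eventually.of_forall hv0) (ball_subset_ball hR.2.le).eventuallyLE)

end SquareExtension

/-- (Subharmonicity of `h²` extended by zero, inequality (2.1).) Let
`Ω ⊂ ℝ^d` be a domain, `h` continuous on `closure Ω`, harmonic in `Ω`, with `h = 0` on
`∂Ω ∩ B(x,r)`, `x ∈ closure Ω`. Let `v = h²` on `Ω ∩ B(x,r)` and `v = 0` off `Ω` (i.e.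
`v = Set.indicator Ω (h²)`). Then `v` satisfies the sub-mean-value inequality on every ball
contained in `B(x,r)`, and consequently for all `y ∈ B(x,r/2) ∩ Ω`,
`h(y)² ≤ |B(y,r/2)|⁻¹ ∫_{B(y,r/2) ∩ Ω} h² ≤ |B(y,r/2)|⁻¹ ∫_{B(x,r) ∩ Ω} h²`. -/
theorem stmt_17 (d : ℕ) (Ω : Set (EuclideanSpace ℝ (Fin d)))
    (hΩ : IsOpen Ω) (hconn : IsConnected Ω)
    (h : EuclideanSpace ℝ (Fin d) → ℝ) (hcont : ContinuousOn h (closure Ω))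
    (hharm : IsHarmonicOn h Ω)
    (x : EuclideanSpace ℝ (Fin d)) (r : ℝ) (hx : x ∈ closure Ω) (hr : 0 < r)
    (hzero : ∀ y ∈ frontier Ω ∩ ball x r, h y = 0) :
    (∀ (y : EuclideanSpace ℝ (Fin d)) (ρ : ℝ), 0 < ρ → ball y ρ ⊆ ball x r →
      Set.indicator Ω (fun z => h z ^ 2) y ≤
        (∫ z in ball y ρ, Set.indicator Ω (fun w => h w ^ 2) z) /
          (volume (ball y ρ)).toReal) ∧
    ∀ y ∈ ball x (r / 2) ∩ Ω,
      h y ^ 2 ≤ (∫ z in ball y (r / 2) ∩ Ω, h z ^ 2) / (volume (ball y (r / 2))).toReal ∧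
      (∫ z in ball y (r / 2) ∩ Ω, h z ^ 2) / (volume (ball y (r / 2))).toReal ≤
        (∫ z in ball x r ∩ Ω, h z ^ 2) / (volume (ball y (r / 2))).toReal := by
  have hsub : ∀ (y : EuclideanSpace ℝ (Fin d)) (ρ : ℝ), 0 < ρ → ball y ρ ⊆ ball x r →
      Set.indicator Ω (fun z => h z ^ 2) y ≤
        (∫ z in ball y ρ, Set.indicator Ω (fun w => h w ^ 2) z) /
          (volume (ball y ρ)).toReal := fun y ρ hρ hy =>
    indicator_sq_le_average hΩ hcont hharm hρ fun z hz => hzero z ⟨hz.1, hy hz.2⟩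
  refine ⟨hsub, fun y hy => ?_⟩
  have hball : ball y (r / 2) ⊆ ball x r :=
    ball_subset_ball' (by linarith [mem_ball.1 hy.1])
  constructor
  · have := hsub y (r / 2) (half_pos hr) hball
    rwa [indicator_of_mem hy.2, setIntegral_indicator hΩ.measurableSet] at this
  · refine div_le_div_of_nonneg_right ?_ ENNReal.toReal_nonneg
    exact setIntegral_mono_set (integrableOn_sq_ball_inter hcont x r)
      (Filter.Eventually.of_forall fun z => sq_nonneg (h z))
      (inter_subset_inter_left Ω hball).eventuallyLE
end
end
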